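/- arXiv:1203.4401 — 4 statements merged into one kernel-verified Lean document; each statement's English description precedes it below -/
import Mathlib

section
/- Let F̂ be a sub-distribution function on [0,M] with ℓ(F̂) > −∞ that maximizes ℓ over all sub-distribution functions on [0,M]. If t ∈ (0,M) satisfies 0 < F̂(t−) ≤ F̂(t) < 1 and h1(t) + h2(t) + ∫_0^t h(v,t) dv + ∫_t^M h(t,v) dv > 0, then F̂(t−) = F̂(t); that is, the maximizer has no jump at t. -/
open MeasureTheory Set Filter
open scoped ENNReal NNReal Topology

noncomputable section

/-- `negLogTerm a x` encodes `- a * log x` as a value in `[0,∞]`, with the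
conventions `log 0 = -∞` and `0 · (-∞) = 0` (since `0 * ⊤ = 0` in `ℝ≥0∞`). -/
def negLogTerm (a x : ℝ) : ℝ≥0∞ :=
  ENNReal.ofReal a * (if x ≤ 0 then ⊤ else ENNReal.ofReal (- Real.log x))

/-- `negLogLik M h1 h2 h F = - ℓ(F)`, the negative of the smoothed log-likelihood.
Since `h1, h2, h ≥ 0` and `F` takes values in `[0,1]`, all three integrands of `ℓ`
are nonpositive, so `ℓ(F)` is faithfully encoded as minus this `[0,∞]`-valued
quantity; `ℓ(F) > -∞` iff `negLogLik ≠ ⊤`, and maximizing `ℓ` is minimizing this. -/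
def negLogLik (M : ℝ) (h1 h2 : ℝ → ℝ) (h : ℝ → ℝ → ℝ) (F : ℝ → ℝ) : ℝ≥0∞ :=
  (∫⁻ t in Icc (0:ℝ) M, negLogTerm (h1 t) (F t)) +
  (∫⁻ t in Icc (0:ℝ) M, negLogTerm (h2 t) (1 - F t)) +
  ∫⁻ p in (Icc (0:ℝ) M ×ˢ Icc (0:ℝ) M) ∩ {p : ℝ × ℝ | p.1 < p.2},
      negLogTerm (h p.1 p.2) (F p.2 - F p.1)

/-- A sub-distribution function on `[0,M]`: nondecreasing, `[0,1]`-valued and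
right-continuous on `[0,M)`. -/
def IsSubDist (M : ℝ) (F : ℝ → ℝ) : Prop :=
  MonotoneOn F (Icc 0 M) ∧ (∀ t ∈ Icc (0:ℝ) M, F t ∈ Icc (0:ℝ) 1) ∧
    ∀ t ∈ Ico (0:ℝ) M, ContinuousWithinAt F (Ici t) t

/-- `F` maximizes the smoothed log-likelihood `ℓ` over all sub-distribution
functions on `[0,M]` (equivalently, minimizes `negLogLik`). -/
def MaximizesEll (M : ℝ) (h1 h2 : ℝ → ℝ) (h : ℝ → ℝ → ℝ) (F : ℝ → ℝ) : Prop :=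
  ∀ G : ℝ → ℝ, IsSubDist M G → negLogLik M h1 h2 h F ≤ negLogLik M h1 h2 h G

/-- The function `∇_F`. -/
def nabla (M : ℝ) (h1 h2 : ℝ → ℝ) (h : ℝ → ℝ → ℝ) (F : ℝ → ℝ) (u : ℝ) : ℝ :=
  if 0 < F u ∧ F u < 1 then
    h1 u / F u - h2 u / (1 - F u)
      + (∫ v in (0:ℝ)..u, h v u / (F u - F v))
      - ∫ v in u..M, h u v / (F v - F u)
  else 0

/-- A quantitative form of `log x ≤ x - 1` away from `x = 1`. -/
lemma log_le_sub_one_sub_sq {x d : ℝ} (hx : 0 < x) (hd : 0 < d) (hd1 : d ≤ 1)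
    (hxd : d ≤ |x - 1|) : Real.log x ≤ x - 1 - d ^ 2 / 9 := by
  obtain ⟨r, hr, rfl⟩ : ∃ r : ℝ, 0 < r ∧ x = r ^ 2 :=
    ⟨√x, Real.sqrt_pos.2 hx, (Real.sq_sqrt hx.le).symm⟩
  have hlog : Real.log (r ^ 2) ≤ 2 * (r - 1) := by
    rw [Real.log_pow]
    push_cast
    linarith [Real.log_le_sub_one_of_pos hr]
  have hsq : d ^ 2 / 9 ≤ (r - 1) ^ 2 := by
    rcases le_total r 2 with h2 | h2
    · have h3 : d ≤ 3 * |r - 1| := by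
        have : |r ^ 2 - 1| = (r + 1) * |r - 1| := by
          rw [show r ^ 2 - 1 = (r + 1) * (r - 1) by ring, abs_mul,
            abs_of_pos (by linarith : 0 < r + 1)]
        rw [this] at hxd
        nlinarith [abs_nonneg (r - 1)]
      rw [← sq_abs (r - 1)]
      nlinarith
    · nlinarith
  nlinarith

lemma ofReal_add_ofReal_le {A B r : ℝ} (hA : 0 ≤ A) (hB : 0 ≤ B) (h : A + r ≤ B) :
    ENNReal.ofReal A + ENNReal.ofReal r ≤ ENNReal.ofReal B + ENNReal.ofReal (-r) := by
  rcases le_total 0 r with hr | hr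
  · rw [← ENNReal.ofReal_add hA hr]
    exact (ENNReal.ofReal_le_ofReal h).trans le_self_add
  · rw [ENNReal.ofReal_of_nonpos hr, add_zero, ← ENNReal.ofReal_add hB (by linarith)]
    exact ENNReal.ofReal_le_ofReal (by linarith)

lemma negLogTerm_zero_left (x : ℝ) : negLogTerm 0 x = 0 := by
  simp [negLogTerm]

lemma negLogTerm_of_pos {w x : ℝ} (hw : 0 ≤ w) (hx : 0 < x) :
    negLogTerm w x = ENNReal.ofReal (w * -Real.log x) := by
  rw [negLogTerm, if_neg hx.not_ge, ENNReal.ofReal_mul hw]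

/-- Strong convexity of `- w log` around `z'`, in a subtraction-free form. -/
lemma negLogTerm_add_le {w z z' d : ℝ} (hw : 0 ≤ w) (hz' : 0 < z') (hz'1 : z' ≤ 1)
    (hz : z ≤ 1) (hd : 0 < d) (hd1 : d ≤ 1) (hzd : d ≤ |z - z'|) :
    negLogTerm w z' + ENNReal.ofReal (w * (d ^ 2 / 9 + (z' - z) / z')) ≤
      negLogTerm w z + ENNReal.ofReal (-(w * (d ^ 2 / 9 + (z' - z) / z'))) := by
  rcases hw.eq_or_lt with rfl | hw0
  · simp [negLogTerm_zero_left]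
  rcases le_or_gt z 0 with hz0 | hz0
  · have : negLogTerm w z = ⊤ := by
      rw [negLogTerm, if_pos hz0]
      exact ENNReal.mul_top (by simpa using hw0)
    simp [this]
  rw [negLogTerm_of_pos hw hz0, negLogTerm_of_pos hw hz']
  apply ofReal_add_ofReal_le
  · exact mul_nonneg hw (neg_nonneg.2 (Real.log_nonpos hz'.le hz'1))
  · exact mul_nonneg hw (neg_nonneg.2 (Real.log_nonpos hz0.le hz))
  · have habs : d ≤ |z / z' - 1| := by
      rw [div_sub_one hz'.ne', abs_div, abs_of_pos hz', le_div_iff₀ hz']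
      nlinarith
    have h1 := log_le_sub_one_sub_sq (div_pos hz0 hz') hd hd1 habs
    rw [Real.log_div hz0.ne' hz'.ne', div_sub_one hz'.ne'] at h1
    have h2 : (z' - z) / z' = -((z - z') / z') := by ring
    rw [h2, ← mul_add]
    apply mul_le_mul_of_nonneg_left _ hw
    linarith

/-- Integrating a pointwise bound `g + r ≤ f` with `f, g` valued in `[0,∞]`. -/
lemma toReal_lintegral_add_integral_le {α : Type*} [MeasurableSpace α] {μ : Measure α}
    {f g : α → ℝ≥0∞} {r : α → ℝ} (hf : ∫⁻ x, f x ∂μ ≠ ⊤) (hr : Integrable r μ)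
    (hle : ∀ᵐ x ∂μ, g x + ENNReal.ofReal (r x) ≤ f x + ENNReal.ofReal (-r x)) :
    ∫⁻ x, g x ∂μ ≠ ⊤ ∧ (∫⁻ x, g x ∂μ).toReal + ∫ x, r x ∂μ ≤ (∫⁻ x, f x ∂μ).toReal := by
  have hint := lintegral_mono_ae hle
  have hm : AEMeasurable (fun x => ENNReal.ofReal (-r x)) μ :=
    hr.neg.aestronglyMeasurable.aemeasurable.ennreal_ofReal
  rw [lintegral_add_right' _ hr.aestronglyMeasurable.aemeasurable.ennreal_ofReal,
    lintegral_add_right' _ hm] at hint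
  have hp : ∫⁻ x, ENNReal.ofReal (r x) ∂μ ≠ ⊤ := hr.lintegral_lt_top.ne
  have hn : ∫⁻ x, ENNReal.ofReal (-r x) ∂μ ≠ ⊤ := hr.neg.lintegral_lt_top.ne
  have hrhs : ∫⁻ x, f x ∂μ + ∫⁻ x, ENNReal.ofReal (-r x) ∂μ ≠ ⊤ := ENNReal.add_ne_top.2 ⟨hf, hn⟩
  have hg : ∫⁻ x, g x ∂μ ≠ ⊤ := (ENNReal.add_ne_top.1 (ne_top_of_le_ne_top hrhs hint)).1
  refine ⟨hg, ?_⟩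
  have h2 := ENNReal.toReal_mono hrhs hint
  rw [ENNReal.toReal_add hg hp, ENNReal.toReal_add hf hn] at h2
  rw [integral_eq_lintegral_pos_part_sub_lintegral_neg_part hr]
  linarith

lemma negLogLik_congr {M : ℝ} {h1 h2 h1' h2' : ℝ → ℝ} {h h' : ℝ → ℝ → ℝ} {F F' : ℝ → ℝ}
    (e1 : EqOn h1 h1' (Icc 0 M)) (e2 : EqOn h2 h2' (Icc 0 M))
    (e : ∀ v ∈ Icc (0:ℝ) M, ∀ u ∈ Icc (0:ℝ) M, h v u = h' v u) (eF : EqOn F F' (Icc 0 M)) :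
    negLogLik M h1 h2 h F = negLogLik M h1' h2' h' F' := by
  unfold negLogLik
  congr 1
  · congr 1
    · exact setLIntegral_congr_fun measurableSet_Icc fun s hs => by simp only [e1 hs, eF hs]
    · exact setLIntegral_congr_fun measurableSet_Icc fun s hs => by simp only [e2 hs, eF hs]
  · refine setLIntegral_congr_fun ?_ fun p hp => ?_
    · exact (measurableSet_Icc.prod measurableSet_Icc).inter
        (measurableSet_lt measurable_fst measurable_snd)
    · simp only [e _ hp.1.1 _ hp.1.2, eF hp.1.1, eF hp.1.2]

/-- The double integral of the likelihood over the full square, when `h` vanishes below the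
diagonal. -/
lemma negLogLik_eq_prod {M : ℝ} {h1 h2 : ℝ → ℝ} {h : ℝ → ℝ → ℝ} {F : ℝ → ℝ}
    (hz : ∀ v u, u ≤ v → h v u = 0) :
    negLogLik M h1 h2 h F =
      (∫⁻ t in Icc (0:ℝ) M, negLogTerm (h1 t) (F t)) +
      (∫⁻ t in Icc (0:ℝ) M, negLogTerm (h2 t) (1 - F t)) +
      ∫⁻ p, negLogTerm (h p.1 p.2) (F p.2 - F p.1)
        ∂((volume.restrict (Icc (0:ℝ) M)).prod (volume.restrict (Icc (0:ℝ) M))) := by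
  unfold negLogLik
  congr 1
  rw [Measure.prod_restrict, ← Measure.volume_eq_prod, inter_comm,
    ← Measure.restrict_restrict (measurableSet_lt measurable_fst measurable_snd),
    ← lintegral_indicator (measurableSet_lt measurable_fst measurable_snd)]
  refine lintegral_congr fun p => ?_
  by_cases hp : p.1 < p.2
  · rw [indicator_of_mem (by exact hp)]
  · rw [indicator_of_notMem (by exact hp), hz _ _ (not_lt.1 hp), negLogTerm_zero_left]

lemma continuous_integral_mul {μ : Measure ℝ} [IsFiniteMeasure μ] {h : ℝ → ℝ → ℝ} {k : ℝ → ℝ}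
    {C K : ℝ} (hh : Continuous fun p : ℝ × ℝ => h p.1 p.2) (hC : ∀ v u, |h v u| ≤ C)
    (hk : Measurable k) (hK : ∀ v, |k v| ≤ K) :
    Continuous fun s => ∫ v, h v s * k v ∂μ := by
  refine continuous_of_dominated (bound := fun _ => C * K) (fun s => ?_) (fun s => ?_)
    (integrable_const _) ?_
  · have : Continuous fun v => h v s := hh.comp (by fun_prop : Continuous fun v : ℝ => (v, s))
    exact (this.measurable.mul hk).aestronglyMeasurable
  · refine Eventually.of_forall fun v => ?_
    rw [Real.norm_eq_abs, abs_mul]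
    exact mul_le_mul (hC _ _) (hK _) (abs_nonneg _) ((abs_nonneg _).trans (hC v s))
  · refine Eventually.of_forall fun v => ?_
    have : Continuous fun s => h v s := hh.comp (by fun_prop : Continuous fun s : ℝ => (v, s))
    exact this.mul continuous_const

lemma integrable_mul_of_bdd {μ : Measure ℝ} [IsFiniteMeasure μ] {h k : ℝ → ℝ}
    {C K : ℝ} (hh : Continuous h) (hC : ∀ v, |h v| ≤ C)
    (hk : Measurable k) (hK : ∀ v, |k v| ≤ K) : Integrable (fun v => h v * k v) μ := by
  refine Integrable.of_bound (hh.measurable.mul hk).aestronglyMeasurable (C * K)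
    (Eventually.of_forall fun v => ?_)
  rw [Real.norm_eq_abs, abs_mul]
  exact mul_le_mul (hC _) (hK _) (abs_nonneg _) ((abs_nonneg _).trans (hC v))

/-- Replacing a sub-distribution function by an intermediate constant on `[p, q)`. -/
lemma IsSubDist.piecewise_const {M p q c : ℝ} {F : ℝ → ℝ} (hF : IsSubDist M F)
    (hc : c ∈ Icc (0:ℝ) 1) (hlo : ∀ s ∈ Icc (0:ℝ) M, s < p → F s ≤ c)
    (hhi : ∀ s ∈ Icc (0:ℝ) M, q ≤ s → c ≤ F s) :
    IsSubDist M ((Ico p q).piecewise (fun _ => c) F) := by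
  obtain ⟨hmono, hval, hcont⟩ := hF
  refine ⟨fun x hx y hy hxy => ?_, fun s hs => ?_, fun s hs => ?_⟩
  · by_cases hxI : x ∈ Ico p q <;> by_cases hyI : y ∈ Ico p q <;>
      simp only [piecewise, hxI, hyI, if_true, if_false, le_refl]
    · exact hhi y hy (not_lt.1 fun hq => hyI ⟨hxI.1.trans hxy, hq⟩)
    · exact hlo x hx (not_le.1 fun hp => hxI ⟨hp, hxy.trans_lt hyI.2⟩)
    · exact hmono hx hy hxy
  · by_cases hsI : s ∈ Ico p q <;> simp only [piecewise, hsI, if_true, if_false]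
    · exact hc
    · exact hval s hs
  · by_cases hsI : s ∈ Ico p q
    · refine ContinuousWithinAt.congr_of_eventuallyEq
        (continuousWithinAt_const (b := c)) ?_ (by simp [piecewise, hsI])
      filter_upwards [self_mem_nhdsWithin, mem_nhdsWithin_of_mem_nhds (Iio_mem_nhds hsI.2)]
        with x hx hxq
      exact piecewise_eq_of_mem _ _ _ ⟨hsI.1.trans hx, hxq⟩
    · refine (hcont s hs).congr_of_eventuallyEq ?_ (by simp [piecewise, hsI])
      rcases lt_or_ge s p with hp | hp
      · filter_upwards [mem_nhdsWithin_of_mem_nhds (Iio_mem_nhds hp)] with x hx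
        exact piecewise_eq_of_notMem _ _ _ fun hxI => (not_le.2 hx) hxI.1
      · filter_upwards [self_mem_nhdsWithin] with x hx
        refine piecewise_eq_of_notMem _ _ _ fun hxI => hsI ⟨hp, ?_⟩
        exact lt_of_le_of_lt hx hxI.2

lemma integral_prod_kernel {μ : Measure ℝ} [IsFiniteMeasure μ] {h : ℝ → ℝ → ℝ}
    {J e k₁ k₂ : ℝ → ℝ} {C K κ : ℝ}
    (hh : Continuous fun p : ℝ × ℝ => h p.1 p.2) (hC : ∀ v u, |h v u| ≤ C)
    (hJ : Measurable J) (hJ1 : ∀ v, |J v| ≤ 1) (he : Measurable e) (he1 : ∀ v, |e v| ≤ 1)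
    (hk₁ : Measurable k₁) (hK₁ : ∀ v, |k₁ v| ≤ 1)
    (hk₂ : Measurable k₂) (hK₂ : ∀ v, |k₂ v| ≤ K) (hκ : 0 ≤ κ) :
    Integrable (fun p : ℝ × ℝ => J p.2 * (h p.1 p.2 * (κ * k₁ p.1 + e p.2 * k₂ p.1))) (μ.prod μ) ∧
    Integrable (fun u => J u * (κ * ∫ v, h v u * k₁ v ∂μ + e u * ∫ v, h v u * k₂ v ∂μ)) μ ∧
    ∫ p, J p.2 * (h p.1 p.2 * (κ * k₁ p.1 + e p.2 * k₂ p.1)) ∂(μ.prod μ) =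
      ∫ u, J u * (κ * ∫ v, h v u * k₁ v ∂μ + e u * ∫ v, h v u * k₂ v ∂μ) ∂μ := by
  have hint : Integrable
      (fun p : ℝ × ℝ => J p.2 * (h p.1 p.2 * (κ * k₁ p.1 + e p.2 * k₂ p.1))) (μ.prod μ) := by
    have hhm := hh.measurable
    refine Integrable.of_bound (Measurable.aestronglyMeasurable (by fun_prop))
      (1 * (C * (κ * 1 + 1 * K))) (Eventually.of_forall fun p => ?_)
    have hC0 : 0 ≤ C := (abs_nonneg _).trans (hC 0 0)
    have hbd : |κ * k₁ p.1 + e p.2 * k₂ p.1| ≤ κ * 1 + 1 * K := by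
      refine (abs_add_le _ _).trans (add_le_add ?_ ?_)
      · rw [abs_mul, abs_of_nonneg hκ]
        exact mul_le_mul_of_nonneg_left (hK₁ _) hκ
      · rw [abs_mul]
        exact mul_le_mul (he1 _) (hK₂ _) (abs_nonneg _) zero_le_one
    rw [Real.norm_eq_abs, abs_mul, abs_mul]
    exact mul_le_mul (hJ1 _) (mul_le_mul (hC _ _) hbd (abs_nonneg _) hC0)
      (mul_nonneg (abs_nonneg _) (abs_nonneg _)) zero_le_one
  have hinner : ∀ u, ∫ v, J u * (h v u * (κ * k₁ v + e u * k₂ v)) ∂μ =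
      J u * (κ * ∫ v, h v u * k₁ v ∂μ + e u * ∫ v, h v u * k₂ v ∂μ) := fun u => by
    have hu : Continuous fun v => h v u := hh.comp (by fun_prop : Continuous fun v : ℝ => (v, u))
    rw [integral_const_mul, ← integral_const_mul κ, ← integral_const_mul (e u), ← integral_add]
    · congr 2
      ext v
      ring
    · exact (integrable_mul_of_bdd hu (fun v => hC v u) hk₁ hK₁).const_mul _
    · exact (integrable_mul_of_bdd hu (fun v => hC v u) hk₂ hK₂).const_mul _
  refine ⟨hint, ?_, ?_⟩
  · exact hint.integral_prod_right.congr (Eventually.of_forall hinner)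
  · rw [integral_prod_symm _ hint]
    exact integral_congr_ae (Eventually.of_forall hinner)

/-- If the strong-convexity lower bound for the gain obtained by flattening `F` to the constant
`c` on `[p, q)` is uniformly positive, then `F` is not a maximizer. -/
lemma not_maximizesEll_of_gain {M ε C d c t p q η : ℝ} {h1 h2 : ℝ → ℝ} {h : ℝ → ℝ → ℝ}
    {F : ℝ → ℝ} (hε : 0 < ε)
    (h1c : Continuous h1) (h2c : Continuous h2) (hc : Continuous fun p : ℝ × ℝ => h p.1 p.2)
    (h1nn : ∀ s, 0 ≤ h1 s) (h2nn : ∀ s, 0 ≤ h2 s) (hnn : ∀ v u, 0 ≤ h v u)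
    (h1C : ∀ s, h1 s ≤ C) (h2C : ∀ s, h2 s ≤ C) (hC : ∀ v u, h v u ≤ C)
    (hsep : ∀ v u, u - v < ε → h v u = 0)
    (hF : IsSubDist M F) (hmono : Monotone F) (hF01 : ∀ s, F s ∈ Icc (0:ℝ) 1)
    (hfin : negLogLik M h1 h2 h F ≠ ⊤)
    (hd : 0 < d) (hd1 : d ≤ 1) (hc0 : 0 < c) (hc1 : c < 1)
    (hlo : ∀ s < t, F s ≤ c - d) (hhi : ∀ s, t ≤ s → c + d ≤ F s)
    (hp0 : 0 ≤ p) (hqM : q ≤ M) (hpq : p < q) (hpt : p ≤ t) (htq : t ≤ q) (hqp : q - p < ε)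
    (hη : 0 < η)
    (hgain : ∀ s ∈ Ico p q, η ≤ h1 s * (d ^ 2 / 9 + (c - F s) / c)
      + h2 s * (d ^ 2 / 9 + (F s - c) / (1 - c))
      + (d ^ 2 / 9 * (∫ v in Icc 0 M, h v s * (Iio t).indicator 1 v)
        + (c - F s) * ∫ v in Icc 0 M, h v s * (Iio t).indicator (fun v => (c - F v)⁻¹) v)
      + (d ^ 2 / 9 * (∫ v in Icc 0 M, h s v * (Ici t).indicator 1 v)
        + (F s - c) * ∫ v in Icc 0 M, h s v * (Ici t).indicator (fun v => (F v - c)⁻¹) v)) :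
    ¬ MaximizesEll M h1 h2 h F := by
  intro hmax
  set μ : Measure ℝ := volume.restrict (Icc (0:ℝ) M) with hμ
  set G : ℝ → ℝ := (Ico p q).piecewise (fun _ => c) F with hG
  have hGin : ∀ s ∈ Ico p q, G s = c := fun s hs => piecewise_eq_of_mem _ _ _ hs
  have hGout : ∀ s ∉ Ico p q, G s = F s := fun s hs => piecewise_eq_of_notMem _ _ _ hs
  have hGsub : IsSubDist M G := hF.piecewise_const ⟨hc0.le, hc1.le⟩
    (fun s _ hs => by linarith [hlo s (hs.trans_le hpt)])
    (fun s _ hs => by linarith [hhi s (htq.trans hs)])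
  have hz : ∀ v u, u ≤ v → h v u = 0 := fun v u huv => hsep v u ((sub_nonpos.2 huv).trans_lt hε)
  have hle := hmax G hGsub
  rw [negLogLik_eq_prod hz, negLogLik_eq_prod hz, ← hμ] at hle
  rw [negLogLik_eq_prod hz, ← hμ] at hfin
  obtain ⟨hfin12, hfin3⟩ := ENNReal.add_ne_top.1 hfin
  obtain ⟨hfin1, hfin2⟩ := ENNReal.add_ne_top.1 hfin12
  have hFm : Measurable F := hmono.measurable
  have hFc : ∀ s, d ≤ |F s - c| := fun s => by
    rcases lt_or_ge s t with hs | hs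
    · rw [abs_sub_comm]
      exact le_trans (by linarith [hlo s hs]) (le_abs_self _)
    · exact le_trans (by linarith [hhi s hs]) (le_abs_self _)
  have hFc1 : ∀ s, |F s - c| ≤ 1 := fun s => by
    rw [abs_le]; constructor <;> linarith [(hF01 s).1, (hF01 s).2]
  have hcF1 : ∀ s, |c - F s| ≤ 1 := fun s => by rw [abs_sub_comm]; exact hFc1 s
  have hκ : 0 ≤ d ^ 2 / 9 := by positivity
  set J : ℝ → ℝ := (Ico p q).indicator 1 with hJdef
  have hJin : ∀ s ∈ Ico p q, J s = 1 := fun s hs => by simp [hJdef, hs]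
  have hJout : ∀ s ∉ Ico p q, J s = 0 := fun s hs => by
    rw [hJdef, indicator_of_notMem hs]
  have hJm : Measurable J := measurable_one.indicator measurableSet_Ico
  have hJ1 : ∀ s, |J s| ≤ 1 := fun s => by
    by_cases hs : s ∈ Ico p q
    · simp [hJin s hs]
    · simp [hJout s hs]
  have hind1 : ∀ (S : Set ℝ) (s : ℝ), |S.indicator (1 : ℝ → ℝ) s| ≤ 1 := fun S s => by
    by_cases hs : s ∈ S <;> simp [hs]
  have hindinv : ∀ (S : Set ℝ) (f : ℝ → ℝ), (∀ s, d ≤ |f s|) →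
      ∀ s, |S.indicator (fun v => (f v)⁻¹) s| ≤ d⁻¹ := fun S f hf s => by
    by_cases hs : s ∈ S
    · rw [indicator_of_mem hs, abs_inv]
      exact inv_anti₀ hd (hf s)
    · rw [indicator_of_notMem hs, abs_zero]
      positivity
  have habs : ∀ v u, |h v u| ≤ C := fun v u => by rw [abs_of_nonneg (hnn v u)]; exact hC v u
  have hA := integral_prod_kernel (μ := μ) (J := J) (e := fun s => c - F s)
    (k₁ := (Iio t).indicator 1) (k₂ := (Iio t).indicator fun v => (c - F v)⁻¹) hc habs
    hJm hJ1 (by fun_prop) hcF1 (measurable_one.indicator measurableSet_Iio) (hind1 _)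
    ((by fun_prop : Measurable fun v => (c - F v)⁻¹).indicator measurableSet_Iio)
    (hindinv _ _ fun s => by rw [abs_sub_comm]; exact hFc s) hκ
  have hB := integral_prod_kernel (μ := μ) (J := J) (e := fun s => F s - c)
    (h := fun u v => h v u)
    (k₁ := (Ici t).indicator 1) (k₂ := (Ici t).indicator fun v => (F v - c)⁻¹)
    (hc.comp continuous_swap) (fun u v => habs v u)
    hJm hJ1 (by fun_prop) hFc1 (measurable_one.indicator measurableSet_Ici) (hind1 _)
    ((by fun_prop : Measurable fun v => (F v - c)⁻¹).indicator measurableSet_Ici)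
    (hindinv _ _ hFc) hκ
  obtain ⟨hAi, hAo, hAe⟩ := hA
  obtain ⟨hBi, hBo, hBe⟩ := hB
  have hBs := hBi.swap
  have hBse := integral_prod_swap (μ := μ) (ν := μ) (fun p : ℝ × ℝ => J p.2 *
    (h p.2 p.1 * (d ^ 2 / 9 * (Ici t).indicator 1 p.1 +
      (F p.2 - c) * (Ici t).indicator (fun v => (F v - c)⁻¹) p.1)))
  have hsing : ∀ (w e : ℝ → ℝ) (a : ℝ), Continuous w → (∀ s, |w s| ≤ C) → Measurable e →
      (∀ s, |e s| ≤ 1) → 0 < a →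
      Integrable (fun s => J s * (w s * (d ^ 2 / 9 + e s / a))) μ := by
    intro w e a hw hwC he he1 ha
    have h0 := integrable_mul_of_bdd (μ := μ) (K := 1 * (d ^ 2 / 9 + 1 / a)) hw hwC
      (k := fun s => J s * (d ^ 2 / 9 + e s / a)) (by fun_prop) fun s => by
        rw [abs_mul]
        refine mul_le_mul (hJ1 s) ?_ (abs_nonneg _) zero_le_one
        refine (abs_add_le _ _).trans ?_
        rw [abs_of_nonneg hκ, abs_div, abs_of_pos ha]
        gcongr
        exact he1 s
    exact h0.congr (Eventually.of_forall fun s => by simp only; ring)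
  have hi1 := hsing h1 (fun s => c - F s) c h1c
    (fun s => by rw [abs_of_nonneg (h1nn s)]; exact h1C s) (by fun_prop) hcF1 hc0
  have hi2 := hsing h2 (fun s => F s - c) (1 - c) h2c
    (fun s => by rw [abs_of_nonneg (h2nn s)]; exact h2C s) (by fun_prop) hFc1 (by linarith)
  obtain ⟨hg1, hb1⟩ := toReal_lintegral_add_integral_le (g := fun s => negLogTerm (h1 s) (G s))
    hfin1 hi1 (Eventually.of_forall fun s => by
      by_cases hs : s ∈ Ico p q
      · simp only [hGin s hs, hJin s hs, one_mul]
        exact negLogTerm_add_le (h1nn s) hc0 hc1.le (hF01 s).2 hd hd1 (hFc s)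
      · simp [hGout s hs, hJout s hs])
  obtain ⟨hg2, hb2⟩ := toReal_lintegral_add_integral_le
    (g := fun s => negLogTerm (h2 s) (1 - G s))
    hfin2 hi2 (Eventually.of_forall fun s => by
      by_cases hs : s ∈ Ico p q
      · simp only [hGin s hs, hJin s hs, one_mul]
        have := negLogTerm_add_le (z := 1 - F s) (z' := 1 - c) (h2nn s) (by linarith)
          (by linarith) (by linarith [(hF01 s).1]) hd hd1
          (by rw [show 1 - F s - (1 - c) = -(F s - c) by ring, abs_neg]; exact hFc s)
        rwa [show 1 - c - (1 - F s) = F s - c by ring] at this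
      · simp [hGout s hs, hJout s hs])
  obtain ⟨hg3, hb3⟩ := toReal_lintegral_add_integral_le
    (g := fun p : ℝ × ℝ => negLogTerm (h p.1 p.2) (G p.2 - G p.1))
    hfin3 (hAi.add hBs) (Eventually.of_forall fun x => by
      obtain ⟨v, u⟩ := x
      simp only [Pi.add_apply, Function.comp_apply, Prod.swap_prod_mk]
      by_cases hh : h v u = 0
      · simp [hh, negLogTerm_zero_left]
      have huv : ε ≤ u - v := not_lt.1 fun hlt => hh (hsep v u hlt)
      by_cases hu : u ∈ Ico p q
      · have hv : v ∉ Ico p q := fun hv => by linarith [hu.2, hv.1]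
        have hvt : v < t := by linarith [hu.2]
        have hvl := hlo v hvt
        simp only [hGin u hu, hGout v hv, hJin u hu, hJout v hv, zero_mul, add_zero, one_mul,
          indicator_of_mem (show v ∈ Iio t from hvt), Pi.one_apply, mul_one]
        have := negLogTerm_add_le (z := F u - F v) (z' := c - F v) (hnn v u) (by linarith)
          (by linarith [(hF01 v).1]) (by linarith [(hF01 u).2, (hF01 v).1]) hd hd1
          (by rw [show F u - F v - (c - F v) = F u - c by ring]; exact hFc u)
        rwa [show c - F v - (F u - F v) = c - F u by ring, div_eq_mul_inv] at this
      by_cases hv : v ∈ Ico p q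
      · have hut : t ≤ u := by linarith [hv.1]
        have hul := hhi u hut
        simp only [hGout u hu, hGin v hv, hJout u hu, hJin v hv, zero_mul, zero_add, one_mul,
          indicator_of_mem (show u ∈ Ici t from hut), Pi.one_apply, mul_one]
        have := negLogTerm_add_le (z := F u - F v) (z' := F u - c) (hnn v u) (by linarith)
          (by linarith [(hF01 u).2]) (by linarith [(hF01 u).2, (hF01 v).1]) hd hd1
          (by rw [show F u - F v - (F u - c) = -(F v - c) by ring, abs_neg]; exact hFc v)
        rwa [show F u - c - (F u - F v) = F v - c by ring, div_eq_mul_inv] at this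
      · simp [hGout u hu, hGout v hv, hJout u hu, hJout v hv])
  rw [integral_add' hAi hBs, hAe] at hb3
  simp only [Function.comp_def] at hb3
  rw [hBse, hBe] at hb3
  have hle' := ENNReal.toReal_mono
    (ENNReal.add_ne_top.2 ⟨ENNReal.add_ne_top.2 ⟨hg1, hg2⟩, hg3⟩) hle
  rw [ENNReal.toReal_add (ENNReal.add_ne_top.2 ⟨hg1, hg2⟩) hg3, ENNReal.toReal_add hg1 hg2,
    ENNReal.toReal_add hfin12 hfin3, ENNReal.toReal_add hfin1 hfin2] at hle'
  have hsum : ∫ s, J s * η ∂μ ≤ ∫ s, (J s * (h1 s * (d ^ 2 / 9 + (c - F s) / c))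
      + J s * (h2 s * (d ^ 2 / 9 + (F s - c) / (1 - c)))
      + J s * (d ^ 2 / 9 * (∫ v, h v s * (Iio t).indicator 1 v ∂μ)
        + (c - F s) * ∫ v, h v s * (Iio t).indicator (fun v => (c - F v)⁻¹) v ∂μ)
      + J s * (d ^ 2 / 9 * (∫ v, h s v * (Ici t).indicator 1 v ∂μ)
        + (F s - c) * ∫ v, h s v * (Ici t).indicator (fun v => (F v - c)⁻¹) v ∂μ)) ∂μ := by
    refine integral_mono ?_ (((hi1.add hi2).add hAo).add hBo) fun s => ?_
    · exact Integrable.of_bound (hJm.mul_const η).aestronglyMeasurable (1 * |η|)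
        (Eventually.of_forall fun s => by
          rw [Real.norm_eq_abs, abs_mul]
          exact mul_le_mul_of_nonneg_right (hJ1 s) (abs_nonneg _))
    · by_cases hs : s ∈ Ico p q
      · simp only [hJin s hs, one_mul]
        exact hgain s hs
      · simp [hJout s hs]
  have hadd := integral_add' ((hi1.add hi2).add hAo) hBo
  rw [integral_add' (hi1.add hi2) hAo, integral_add' hi1 hi2] at hadd
  replace hsum := hsum.trans_eq hadd
  have hJint : ∫ s, J s ∂μ = μ.real (Ico p q) := integral_indicator_one measurableSet_Ico
  rw [integral_mul_const, hJint] at hsum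
  have hμI : μ.real (Ico p q) = q - p := by
    rw [hμ, measureReal_restrict_apply measurableSet_Ico,
      inter_eq_left.2 (Ico_subset_Icc_self.trans (Icc_subset_Icc hp0 hqM)),
      Real.volume_real_Ico_of_le hpq.le]
  rw [hμI] at hsum
  have : 0 < (q - p) * η := mul_pos (by linarith) hη
  linarith

/-- For globally defined data, a function with a jump at a point with positive total weight is
not a maximizer. -/
lemma not_maximizesEll_of_jump {M ε C a b t : ℝ} {h1 h2 : ℝ → ℝ} {h : ℝ → ℝ → ℝ}
    {F : ℝ → ℝ} (hε : 0 < ε)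
    (h1c : Continuous h1) (h2c : Continuous h2) (hc : Continuous fun p : ℝ × ℝ => h p.1 p.2)
    (h1nn : ∀ s, 0 ≤ h1 s) (h2nn : ∀ s, 0 ≤ h2 s) (hnn : ∀ v u, 0 ≤ h v u)
    (h1C : ∀ s, h1 s ≤ C) (h2C : ∀ s, h2 s ≤ C) (hC : ∀ v u, h v u ≤ C)
    (hsep : ∀ v u, u - v < ε → h v u = 0)
    (hF : IsSubDist M F) (hmono : Monotone F) (hF01 : ∀ s, F s ∈ Icc (0:ℝ) 1)
    (hfin : negLogLik M h1 h2 h F ≠ ⊤) (ht : t ∈ Ioo 0 M)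
    (ha : 0 ≤ a) (hab : a < b) (hb : b ≤ 1)
    (hlo : ∀ s < t, F s ≤ a) (hhi : ∀ s, t ≤ s → b ≤ F s)
    (hpos : 0 < h1 t + h2 t + (∫ v in (0:ℝ)..t, h v t) + ∫ v in t..M, h t v) :
    ¬ MaximizesEll M h1 h2 h F := by
  obtain ⟨ht0, htM⟩ := ht
  obtain ⟨c, hcdef⟩ : ∃ c, c = (a + b) / 2 := ⟨_, rfl⟩
  obtain ⟨d, hddef⟩ : ∃ d, d = (b - a) / 2 := ⟨_, rfl⟩
  have hd : 0 < d := by linarith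
  have hc0 : 0 < c := by linarith
  have hc1 : c < 1 := by linarith
  have hlo' : ∀ s < t, F s ≤ c - d := fun s hs => by linarith [hlo s hs]
  have hhi' : ∀ s, t ≤ s → c + d ≤ F s := fun s hs => by linarith [hhi s hs]
  set μ : Measure ℝ := volume.restrict (Icc (0:ℝ) M) with hμ
  have hFm : Measurable F := hmono.measurable
  have hindinv : ∀ (S : Set ℝ) (f : ℝ → ℝ), (∀ s ∈ S, d ≤ f s) →
      ∀ s, |S.indicator (fun v => (f v)⁻¹) s| ≤ d⁻¹ := fun S f hf s => by
    by_cases hs : s ∈ S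
    · rw [indicator_of_mem hs, abs_inv]
      exact inv_anti₀ hd ((hf s hs).trans (le_abs_self _))
    · rw [indicator_of_notMem hs, abs_zero]
      positivity
  have hind1 : ∀ (S : Set ℝ) (s : ℝ), |S.indicator (1 : ℝ → ℝ) s| ≤ 1 := fun S s => by
    by_cases hs : s ∈ S <;> simp [hs]
  have habs : ∀ v u, |h v u| ≤ C := fun v u => by rw [abs_of_nonneg (hnn v u)]; exact hC v u
  have hc' : Continuous fun p : ℝ × ℝ => h p.2 p.1 := hc.comp continuous_swap
  obtain ⟨A₁, hA₁⟩ : ∃ A : ℝ → ℝ, A = fun s => ∫ v, h v s * (Iio t).indicator 1 v ∂μ := ⟨_, rfl⟩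
  obtain ⟨A₂, hA₂⟩ : ∃ A : ℝ → ℝ,
    A = fun s => ∫ v, h v s * (Iio t).indicator (fun v => (c - F v)⁻¹) v ∂μ := ⟨_, rfl⟩
  obtain ⟨B₁, hB₁⟩ : ∃ A : ℝ → ℝ, A = fun s => ∫ v, h s v * (Ici t).indicator 1 v ∂μ := ⟨_, rfl⟩
  obtain ⟨B₂, hB₂⟩ : ∃ A : ℝ → ℝ,
    A = fun s => ∫ v, h s v * (Ici t).indicator (fun v => (F v - c)⁻¹) v ∂μ := ⟨_, rfl⟩
  have hA₁c : Continuous A₁ := hA₁ ▸ continuous_integral_mul hc habs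
    (measurable_one.indicator measurableSet_Iio) (hind1 _)
  have hB₁c : Continuous B₁ := hB₁ ▸ continuous_integral_mul (h := fun u v => h v u) hc'
    (fun u v => habs v u) (measurable_one.indicator measurableSet_Ici) (hind1 _)
  have hA₂c : Continuous A₂ := hA₂ ▸ continuous_integral_mul hc habs
    ((by fun_prop : Measurable fun v => (c - F v)⁻¹).indicator measurableSet_Iio)
    (hindinv _ _ fun s hs => by linarith [hlo' s hs])
  have hB₂c : Continuous B₂ := hB₂ ▸ continuous_integral_mul (h := fun u v => h v u) hc'
    (fun u v => habs v u)
    ((by fun_prop : Measurable fun v => (F v - c)⁻¹).indicator measurableSet_Ici)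
    (hindinv _ _ fun s hs => by linarith [hhi' s hs])
  have hA₁t : A₁ t = ∫ v in (0:ℝ)..t, h v t := by
    have : ∀ v, h v t * (Iio t).indicator 1 v = (Iio t).indicator (fun v => h v t) v := fun v => by
      by_cases hv : v ∈ Iio t <;> simp [hv]
    rw [hA₁]
    simp only [this]
    rw [integral_indicator measurableSet_Iio, hμ, Measure.restrict_restrict measurableSet_Iio,
      intervalIntegral.integral_of_le ht0.le, ← integral_Ico_eq_integral_Ioc]
    congr 2
    ext v
    simp only [mem_inter_iff, mem_Iio, mem_Icc, mem_Ico]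
    exact ⟨fun hv => ⟨hv.2.1, hv.1⟩, fun hv => ⟨hv.2, hv.1, by linarith [hv.2]⟩⟩
  have hB₁t : B₁ t = ∫ v in t..M, h t v := by
    have : ∀ v, h t v * (Ici t).indicator 1 v = (Ici t).indicator (fun v => h t v) v := fun v => by
      by_cases hv : v ∈ Ici t <;> simp [hv]
    rw [hB₁]
    simp only [this]
    rw [integral_indicator measurableSet_Ici, hμ, Measure.restrict_restrict measurableSet_Ici,
      intervalIntegral.integral_of_le htM.le, ← integral_Icc_eq_integral_Ioc]
    congr 2
    ext v
    simp only [mem_inter_iff, mem_Ici, mem_Icc]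
    exact ⟨fun hv => ⟨hv.1, hv.2.2⟩, fun hv => ⟨hv.1, by linarith [hv.1], hv.2⟩⟩
  obtain ⟨W, hW⟩ : ∃ W : ℝ → ℝ, W = fun s => h1 s + h2 s + A₁ s + B₁ s := ⟨_, rfl⟩
  obtain ⟨D, hD⟩ : ∃ D : ℝ → ℝ, D = fun s => h1 s / c - h2 s / (1 - c) + A₂ s - B₂ s := ⟨_, rfl⟩
  have hWc : Continuous W := by rw [hW]; fun_prop
  have hDc : Continuous D := by rw [hD]; fun_prop
  have hWt : 0 < W t := by rw [hW]; simp only [hA₁t, hB₁t]; exact hpos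
  obtain ⟨κ, hκ⟩ : ∃ κ, κ = d ^ 2 / 9 := ⟨_, rfl⟩
  have hκ0 : 0 < κ := by rw [hκ]; positivity
  obtain ⟨η, hηdef⟩ : ∃ η, η = κ * W t / 4 := ⟨_, rfl⟩
  have hη : 0 < η := by rw [hηdef]; positivity
  have hev : ∀ᶠ s in 𝓝 t, W t / 2 < W s ∧ D t - η < D s ∧ D s < D t + η := by
    filter_upwards [hWc.continuousAt.eventually (lt_mem_nhds (by linarith : W t / 2 < W t)),
      hDc.continuousAt.eventually (lt_mem_nhds (by linarith : D t - η < D t)),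
      hDc.continuousAt.eventually (gt_mem_nhds (by linarith : D t < D t + η))] with s h₁ h₂ h₃
    exact ⟨h₁, h₂, h₃⟩
  obtain ⟨δ, hδ, hball⟩ := Metric.eventually_nhds_iff.1 hev
  obtain ⟨r, hr0, hrδ, hrε, hrt, hrM⟩ : ∃ r : ℝ, 0 < r ∧ r < δ ∧ r < ε ∧ r < t ∧ r < M - t := by
    refine ⟨min (min δ ε) (min t (M - t)) / 2, ?_, ?_, ?_, ?_, ?_⟩
    · have : 0 < min (min δ ε) (min t (M - t)) :=
        lt_min (lt_min hδ hε) (lt_min ht0 (by linarith))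
      linarith
    · linarith [min_le_left (min δ ε) (min t (M - t)), min_le_left δ ε]
    · linarith [min_le_left (min δ ε) (min t (M - t)), min_le_right δ ε]
    · linarith [min_le_right (min δ ε) (min t (M - t)), min_le_left t (M - t)]
    · linarith [min_le_right (min δ ε) (min t (M - t)), min_le_right t (M - t)]
  have hκW : ∀ s, W t / 2 < W s → 2 * η ≤ κ * W s := fun s hs => by
    rw [hηdef]; nlinarith
  have main : ∀ p q, 0 ≤ p → q ≤ M → p < q → p ≤ t → t ≤ q → q - p < ε →
      (∀ s ∈ Ico p q, |s - t| < δ ∧ -η ≤ (c - F s) * D s) → ¬ MaximizesEll M h1 h2 h F := by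
    intro p q hp0 hqM hpq hpt htq hqp hs
    refine not_maximizesEll_of_gain hε h1c h2c hc h1nn h2nn hnn h1C h2C hC hsep hF hmono hF01 hfin
      hd (by linarith) hc0 hc1 hlo' hhi' hp0 hqM hpq hpt htq hqp hη fun s hsI => ?_
    obtain ⟨hsd, hsD⟩ := hs s hsI
    have h2η := hκW s (hball (by rwa [Real.dist_eq])).1
    have e₁ := congrFun hA₁ s
    have e₂ := congrFun hA₂ s
    have e₃ := congrFun hB₁ s
    have e₄ := congrFun hB₂ s
    rw [← hμ, ← e₁, ← e₂, ← e₃, ← e₄, ← hκ]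
    have : h1 s * (κ + (c - F s) / c) + h2 s * (κ + (F s - c) / (1 - c))
        + (κ * A₁ s + (c - F s) * A₂ s) + (κ * B₁ s + (F s - c) * B₂ s)
        = (c - F s) * D s + κ * W s := by
      simp only [hD, hW]
      ring
    rw [this]
    linarith
  rcases le_total 0 (D t) with hDt | hDt
  · refine main (t - r) t (by linarith) htM.le (by linarith) (by linarith) le_rfl (by linarith)
      fun s hs => ?_
    have hsd : |s - t| < δ := by rw [abs_lt]; constructor <;> linarith [hs.1, hs.2]
    refine ⟨hsd, ?_⟩
    have := (hball (by rwa [Real.dist_eq])).2.1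
    have h₁ := hlo' s hs.2
    have h₂ := (hF01 s).1
    nlinarith
  · refine main t (t + r) ht0.le (by linarith) (by linarith) le_rfl (by linarith) (by linarith)
      fun s hs => ?_
    have hsd : |s - t| < δ := by rw [abs_lt]; constructor <;> linarith [hs.1, hs.2]
    refine ⟨hsd, ?_⟩
    have := (hball (by rwa [Real.dist_eq])).2.2
    have h₁ := hhi' s hs.1
    have h₂ := (hF01 s).2
    nlinarith

/-- a maximizer of the smoothed log-likelihood has no jump at an
interior point `t` with `0 < F̂(t-) ≤ F̂(t) < 1` where the data are not all zero. -/
theorem stmt_2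
    (M ε : ℝ) (hM : 0 < M) (hε : ε ∈ Ioc (0:ℝ) (M / 2))
    (h1 h2 : ℝ → ℝ) (h : ℝ → ℝ → ℝ)
    (h1cont : ContinuousOn h1 (Icc 0 M)) (h2cont : ContinuousOn h2 (Icc 0 M))
    (h1nn : ∀ t ∈ Icc (0:ℝ) M, 0 ≤ h1 t) (h2nn : ∀ t ∈ Icc (0:ℝ) M, 0 ≤ h2 t)
    (hcont : ContinuousOn (fun p : ℝ × ℝ => h p.1 p.2) (Icc 0 M ×ˢ Icc 0 M))
    (hnn : ∀ t u, t ∈ Icc (0:ℝ) M → u ∈ Icc (0:ℝ) M → 0 ≤ h t u)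
    (hsep : ∀ t u : ℝ, u - t < ε → h t u = 0)
    (Fhat : ℝ → ℝ) (hFhat : IsSubDist M Fhat)
    (hfin : negLogLik M h1 h2 h Fhat ≠ ⊤)
    (hmax : MaximizesEll M h1 h2 h Fhat)
    (t : ℝ) (ht : t ∈ Ioo (0:ℝ) M)
    (hleft : 0 < Function.leftLim Fhat t)
    (hle : Function.leftLim Fhat t ≤ Fhat t) (hlt : Fhat t < 1)
    (hpos : 0 < h1 t + h2 t + (∫ v in (0:ℝ)..t, h v t) + ∫ v in t..M, h t v) :
    Function.leftLim Fhat t = Fhat t := by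
  by_contra hne
  have hlt' : Function.leftLim Fhat t < Fhat t := lt_of_le_of_ne hle hne
  obtain ⟨π, hπdef⟩ : ∃ π : ℝ → ℝ, π = fun s => max 0 (min M s) := ⟨_, rfl⟩
  have hπc : Continuous π := by rw [hπdef]; fun_prop
  have hπm : Monotone π := fun x y hxy => by
    rw [hπdef]; exact max_le_max le_rfl (min_le_min le_rfl hxy)
  have hπI : ∀ s, π s ∈ Icc 0 M := fun s => by
    rw [hπdef]; exact ⟨le_max_left _ _, max_le hM.le (min_le_left _ _)⟩
  have hπid : ∀ s ∈ Icc 0 M, π s = s := fun s hs => by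
    rw [hπdef]; simp only [min_eq_right hs.2, max_eq_right hs.1]
  have hπlip : ∀ v u, u - v < ε → π u - π v < ε := fun v u huv => by
    have := hε.1
    simp only [hπdef, max_def, min_def]
    split_ifs <;> linarith
  have htI : t ∈ Icc 0 M := ⟨ht.1.le, ht.2.le⟩
  obtain ⟨hFmono, hFval, hFcont⟩ := hFhat
  have hF'mono : Monotone fun s => Fhat (π s) := fun x y hxy =>
    hFmono (hπI x) (hπI y) (hπm hxy)
  have heq : EqOn (fun s => Fhat (π s)) Fhat (Icc 0 M) := fun s hs => by simp only [hπid s hs]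
  have e1 : EqOn (fun s => h1 (π s)) h1 (Icc 0 M) := fun s hs => by simp only [hπid s hs]
  have e2 : EqOn (fun s => h2 (π s)) h2 (Icc 0 M) := fun s hs => by simp only [hπid s hs]
  have e3 : ∀ v ∈ Icc (0:ℝ) M, ∀ u ∈ Icc (0:ℝ) M, h (π v) (π u) = h v u := fun v hv u hu => by
    rw [hπid v hv, hπid u hu]
  have hF'sub : IsSubDist M fun s => Fhat (π s) := by
    refine ⟨hF'mono.monotoneOn _, fun s _ => hFval _ (hπI s), fun s hs => ?_⟩
    refine (hFcont s hs).congr_of_eventuallyEq ?_ (heq ⟨hs.1, hs.2.le⟩)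
    filter_upwards [self_mem_nhdsWithin, mem_nhdsWithin_of_mem_nhds (Iio_mem_nhds hs.2)]
      with x hx hxM
    exact heq ⟨hs.1.trans hx, (mem_Iio.1 hxM).le⟩
  have hlim : Function.leftLim Fhat t = Function.leftLim (fun s => Fhat (π s)) t := by
    refine leftLim_eq_of_tendsto ?_
    refine (hF'mono.tendsto_leftLim t).congr' ?_
    filter_upwards [self_mem_nhdsWithin, mem_nhdsWithin_of_mem_nhds (Ioi_mem_nhds ht.1)]
      with x hx hx0
    exact heq ⟨(mem_Ioi.1 hx0).le, (mem_Iio.1 hx).le.trans ht.2.le⟩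
  obtain ⟨C₁, hC₁⟩ := isCompact_Icc.exists_bound_of_continuousOn h1cont
  obtain ⟨C₂, hC₂⟩ := isCompact_Icc.exists_bound_of_continuousOn h2cont
  obtain ⟨C₃, hC₃⟩ := (isCompact_Icc.prod isCompact_Icc).exists_bound_of_continuousOn hcont
  refine not_maximizesEll_of_jump (M := M) (h1 := fun s => h1 (π s)) (h2 := fun s => h2 (π s))
    (h := fun v u => h (π v) (π u)) (F := fun s => Fhat (π s)) (C := max C₁ (max C₂ C₃))
    (a := Function.leftLim Fhat t) (b := Fhat t) (t := t) hε.1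
    (h1cont.comp_continuous hπc hπI) (h2cont.comp_continuous hπc hπI)
    (hcont.comp_continuous (f := fun p : ℝ × ℝ => (π p.1, π p.2)) (by fun_prop)
      fun p => ⟨hπI _, hπI _⟩)
    (fun s => h1nn _ (hπI s)) (fun s => h2nn _ (hπI s)) (fun v u => hnn _ _ (hπI v) (hπI u))
    (fun s => (Real.le_norm_self _).trans ((hC₁ _ (hπI s)).trans (le_max_left _ _)))
    (fun s => (Real.le_norm_self _).trans ((hC₂ _ (hπI s)).trans
      ((le_max_left _ _).trans (le_max_right _ _))))
    (fun v u => (Real.le_norm_self _).trans ((hC₃ (π v, π u) ⟨hπI v, hπI u⟩).trans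
      ((le_max_right _ _).trans (le_max_right _ _))))
    (fun v u huv => hsep _ _ (hπlip v u huv)) hF'sub hF'mono (fun s => hFval _ (hπI s))
    ?_ ht hleft.le hlt' hlt.le (fun s hs => ?_) (fun s hs => ?_) ?_ ?_
  · rwa [negLogLik_congr e1 e2 e3 heq]
  · rw [hlim]
    exact hF'mono.le_leftLim hs
  · rw [← heq htI]
    exact hF'mono hs
  · have i1 : ∫ v in (0:ℝ)..t, h (π v) (π t) = ∫ v in (0:ℝ)..t, h v t :=
      intervalIntegral.integral_congr fun v hv => by
        rw [uIcc_of_le ht.1.le] at hv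
        exact e3 v ⟨hv.1, hv.2.trans ht.2.le⟩ t htI
    have i2 : ∫ v in t..M, h (π t) (π v) = ∫ v in t..M, h t v :=
      intervalIntegral.integral_congr fun v hv => by
        rw [uIcc_of_le ht.2.le] at hv
        exact e3 t htI v ⟨ht.1.le.trans hv.1, hv.2⟩
    rw [i1, i2, hπid t htI]
    exact hpos
  · intro G hG
    rw [negLogLik_congr e1 e2 e3 heq, negLogLik_congr e1 e2 e3 (eqOn_refl G _)]
    exact hmax G hG
end
end

section
/- Assume in addition that g(t,u) > 0 whenever 0 ≤ t < u ≤ M and u − t > ε. Let (h_{n1}), (h_{n2}) be sequences of nonnegative continuous functions on [0,M] converging uniformly to h01 and h02 respectively, and let (h_n) be a sequence of nonnegative continuous functions on [0,M]² with h_n(t,u) = 0 whenever u − t < ε, converging uniformly to h0. For each n let F̂_n be a sub-distribution function maximizing ℓ_n(F) = ∫_0^M h_{n1}(t) log F(t) dt + ∫_0^M h_{n2}(t) log(1−F(t)) dt + ∫∫_{0≤t<u≤M} h_n(t,u) log(F(u)−F(t)) dt du over all sub-distribution functions on [0,M]. Then F̂_n(t) → F0(t) for every t ∈ [0,M), and the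 convergence is uniform on every interval [a,b] ⊂ (0,M). -/
open MeasureTheory Set Filter
open scoped ENNReal NNReal Topology

noncomputable section

/-- The triangle `{0 ≤ t < u ≤ M}` over which the observation density lives. -/
def obsTriangle (M : ℝ) : Set (ℝ × ℝ) :=
  (Icc (0:ℝ) M ×ˢ Icc (0:ℝ) M) ∩ {p : ℝ × ℝ | p.1 < p.2}

lemma measurableSet_obsTriangle (M : ℝ) : MeasurableSet (obsTriangle M) :=
  (measurableSet_Icc.prod measurableSet_Icc).inter (measurableSet_lt measurable_fst measurable_snd)

lemma volume_obsTriangle_lt_top (M : ℝ) : volume (obsTriangle M) < ⊤ :=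
  lt_of_le_of_lt (measure_mono inter_subset_left)
    (isCompact_Icc.prod isCompact_Icc).measure_lt_top

lemma sqrt_mul_sqrt_le {f x : ℝ} (hf : f ∈ Icc (0:ℝ) 1) (hx : x ∈ Icc (0:ℝ) 1) :
    √f * √x ≤ (f + x) / 2 - (f - x) ^ 2 / 8 := by
  obtain ⟨hf0, hf1⟩ := hf
  obtain ⟨hx0, hx1⟩ := hx
  have hp := Real.sq_sqrt hf0
  have hq := Real.sq_sqrt hx0
  have hp0 := Real.sqrt_nonneg f
  have hq0 := Real.sqrt_nonneg x
  have hp1 : √f ≤ 1 := Real.sqrt_le_one.mpr hf1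
  have hq1 : √x ≤ 1 := Real.sqrt_le_one.mpr hx1
  set p := √f
  set q := √x
  have h4 : (p + q) ^ 2 ≤ 4 := by nlinarith
  have : (f - x) ^ 2 = (p - q) ^ 2 * (p + q) ^ 2 := by rw [← hp, ← hq]; ring
  have h5 : (f - x) ^ 2 ≤ (p - q) ^ 2 * 4 := by
    rw [this]; exact mul_le_mul_of_nonneg_left h4 (sq_nonneg _)
  nlinarith

lemma mul_sqrt_div_add_le {a γ f x y e η b : ℝ} (hγ : 0 ≤ γ)
    (hf : f ∈ Icc (0:ℝ) 1) (hx : x ∈ Icc (0:ℝ) 1) (hη : 0 < η) (hb : 0 < b)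
    (hae : |a - γ * f| ≤ e) (hby : b ≤ y) (hfy : f ≤ (1 + η) * y) :
    a * √(x / y) + (γ * f + γ * (f - x) ^ 2 / 8)
      ≤ a + (γ * (1 + η) * ((f + x) / 2) + e * (1 + √(1 / b))) := by
  have hy : 0 < y := hb.trans_le hby
  have he : 0 ≤ e := (abs_nonneg _).trans hae
  obtain ⟨h1, h2⟩ := abs_le.mp hae
  have hs0 : 0 ≤ √(x / y) := Real.sqrt_nonneg _
  have hsD : √(x / y) ≤ √(1 / b) := by
    apply Real.sqrt_le_sqrt
    exact div_le_div₀ zero_le_one hx.2 hb hby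
  have hA : a * √(x / y) ≤ γ * f * √(x / y) + e * √(1 / b) := by
    have := mul_le_mul_of_nonneg_right h2 hs0
    have := mul_le_mul_of_nonneg_left hsD he
    nlinarith
  have hfs : f * √(x / y) ≤ (1 + η) * (√f * √x) := by
    have hfy' : √f / √y ≤ 1 + η := by
      rw [← Real.sqrt_div hf.1]
      rw [Real.sqrt_le_left (by linarith)]
      rw [div_le_iff₀ hy]
      nlinarith [mul_nonneg (mul_nonneg hη.le (by linarith : 0 ≤ 1 + η)) hy.le]
    calc f * √(x / y) = (√f / √y) * (√f * √x) := by
          rw [Real.sqrt_div hx.1]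
          nth_rewrite 1 [← Real.mul_self_sqrt hf.1]
          ring
      _ ≤ _ := mul_le_mul_of_nonneg_right hfy' (by positivity)
  have hB := sqrt_mul_sqrt_le hf hx
  have hC : f * √(x / y) ≤ (1 + η) * ((f + x) / 2) - (f - x) ^ 2 / 8 := by
    have := mul_le_mul_of_nonneg_left hB (by linarith : 0 ≤ 1 + η)
    nlinarith [mul_nonneg hη.le (sq_nonneg (f - x))]
  have hD := mul_le_mul_of_nonneg_left hC hγ
  nlinarith

lemma log_sub_log_le_sqrt {x y : ℝ} (hx : 0 < x) (hy : 0 < y) :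
    Real.log x - Real.log y ≤ 2 * (√(x / y) - 1) := by
  have h := Real.log_le_sub_one_of_pos (Real.sqrt_pos.mpr (div_pos hx hy))
  rw [Real.log_sqrt (div_pos hx hy).le, Real.log_div hx.ne' hy.ne'] at h
  linarith

lemma negLogTerm_add_le_s8 {a γ f x y e η b : ℝ} (ha : 0 ≤ a) (hγ : 0 ≤ γ)
    (hf : f ∈ Icc (0:ℝ) 1) (hx : x ∈ Icc (0:ℝ) 1) (hη : 0 < η) (hb : 0 < b)
    (hae : |a - γ * f| ≤ e)
    (hcase : (a = 0 ∧ γ = 0) ∨ (b ≤ y ∧ y ≤ 1 ∧ f ≤ (1 + η) * y)) :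
    negLogTerm a y + ENNReal.ofReal (2 * (γ * f + γ * (f - x) ^ 2 / 8))
      ≤ negLogTerm a x +
        ENNReal.ofReal (2 * (γ * (1 + η) * ((f + x) / 2) + e * (1 + √(1 / b)))) := by
  have he : 0 ≤ e := (abs_nonneg _).trans hae
  rcases hcase with ⟨rfl, rfl⟩ | ⟨hby, hy1, hfy⟩
  · simp [negLogTerm]
  have hy : 0 < y := hb.trans_le hby
  have hmain := mul_sqrt_div_add_le hγ hf hx hη hb hae hby hfy
  have hR2 : 0 ≤ 2 * (γ * f + γ * (f - x) ^ 2 / 8) := by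
    have := hf.1
    positivity
  have hR1 : 0 ≤ 2 * (γ * (1 + η) * ((f + x) / 2) + e * (1 + √(1 / b))) := by
    have := hf.1
    have := hx.1
    positivity
  rcases ha.eq_or_lt with rfl | ha'
  · simp only [negLogTerm, ENNReal.ofReal_zero, zero_mul, zero_add]
    apply ENNReal.ofReal_le_ofReal
    linarith
  rcases hx.1.eq_or_lt with rfl | hx'
  · have : negLogTerm a 0 = ⊤ := by
      simp [negLogTerm, ENNReal.mul_top, ha']
    simp [this]
  simp only [negLogTerm, not_le.mpr hy, not_le.mpr hx', if_false]
  have hly := Real.log_nonpos hy.le hy1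
  have hlx := Real.log_nonpos hx'.le hx.2
  rw [← ENNReal.ofReal_mul ha, ← ENNReal.ofReal_mul ha,
    ← ENNReal.ofReal_add (mul_nonneg ha (by linarith)) hR2,
    ← ENNReal.ofReal_add (mul_nonneg ha (by linarith)) hR1]
  apply ENNReal.ofReal_le_ofReal
  have := mul_le_mul_of_nonneg_left (log_sub_log_le_sqrt hx' hy) ha
  nlinarith

section DivergenceBound

variable {α : Type*} [MeasurableSpace α] {μ : Measure α}
  {a γ f x y : α → ℝ} {e η b : ℝ}

lemma lintegral_negLogTerm_ne_top [IsFiniteMeasure μ] (hb : 0 < b) (hγi : Integrable γ μ)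
    (H : ∀ᵐ z ∂μ, 0 ≤ γ z ∧ f z ∈ Icc (0:ℝ) 1 ∧ |a z - γ z * f z| ≤ e ∧
      ((a z = 0 ∧ γ z = 0) ∨ b ≤ y z)) :
    ∫⁻ z, negLogTerm (a z) (y z) ∂μ ≠ ⊤ := by
  have hle : ∀ᵐ z ∂μ, negLogTerm (a z) (y z)
      ≤ ENNReal.ofReal (γ z + e) * ENNReal.ofReal (- Real.log b) := by
    filter_upwards [H] with z hz
    obtain ⟨hγ, hf, hae, h | h⟩ := hz
    · simp [negLogTerm, h.1]
    · have hy := hb.trans_le h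
      rw [negLogTerm, if_neg (not_le.mpr hy)]
      gcongr
      have := (abs_le.mp hae).2
      nlinarith [hf.2]
  refine ((lintegral_mono_ae hle).trans_lt ?_).ne
  rw [lintegral_mul_const' _ _ ENNReal.ofReal_ne_top]
  exact ENNReal.mul_lt_top (hγi.add (integrable_const e)).lintegral_lt_top ENNReal.ofReal_lt_top

lemma integrable_mul_of_abs_le {C : ℝ} (hγi : Integrable γ μ) (hf : AEStronglyMeasurable f μ)
    (H : ∀ᵐ z ∂μ, |f z| ≤ C) : Integrable (fun z => γ z * f z) μ :=
  hγi.mul_bdd hf H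

lemma integrable_divergence_terms (hγi : Integrable γ μ) (hfm : AEStronglyMeasurable f μ)
    (hxm : AEStronglyMeasurable x μ)
    (H : ∀ᵐ z ∂μ, f z ∈ Icc (0:ℝ) 1 ∧ x z ∈ Icc (0:ℝ) 1) :
    Integrable (fun z => γ z * f z) μ ∧ Integrable (fun z => γ z * x z) μ ∧
      Integrable (fun z => γ z * (f z - x z) ^ 2) μ := by
  refine ⟨integrable_mul_of_abs_le (C := 1) hγi hfm ?_,
    integrable_mul_of_abs_le (C := 1) hγi hxm ?_,
    integrable_mul_of_abs_le (C := 1) hγi ((hfm.sub hxm).pow 2) ?_⟩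
  · filter_upwards [H] with z hz
    rw [abs_of_nonneg hz.1.1]; exact hz.1.2
  · filter_upwards [H] with z hz
    rw [abs_of_nonneg hz.2.1]; exact hz.2.2
  · filter_upwards [H] with z hz
    obtain ⟨⟨h1, h2⟩, h3, h4⟩ := hz
    rw [abs_of_nonneg (sq_nonneg _)]
    nlinarith

lemma lintegral_negLogTerm_add_le [IsFiniteMeasure μ] (hη : 0 < η) (hb : 0 < b) (he : 0 ≤ e) (hγi : Integrable γ μ)
    (hfm : AEStronglyMeasurable f μ) (hxm : AEStronglyMeasurable x μ)
    (H : ∀ᵐ z ∂μ, 0 ≤ a z ∧ 0 ≤ γ z ∧ f z ∈ Icc (0:ℝ) 1 ∧ x z ∈ Icc (0:ℝ) 1 ∧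
      |a z - γ z * f z| ≤ e ∧
      ((a z = 0 ∧ γ z = 0) ∨ (b ≤ y z ∧ y z ≤ 1 ∧ f z ≤ (1 + η) * y z))) :
    ∫⁻ z, negLogTerm (a z) (y z) ∂μ +
        ENNReal.ofReal (2 * ∫ z, γ z * f z ∂μ + (∫ z, γ z * (f z - x z) ^ 2 ∂μ) / 4)
      ≤ ∫⁻ z, negLogTerm (a z) (x z) ∂μ +
        ENNReal.ofReal ((1 + η) * (∫ z, γ z * f z ∂μ + ∫ z, γ z * x z ∂μ)
          + 2 * e * (1 + √(1 / b)) * μ.real univ) := by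
  obtain ⟨i1, i2, i3⟩ := integrable_divergence_terms hγi hfm hxm
    (H.mono fun z hz => ⟨hz.2.2.1, hz.2.2.2.1⟩)
  have j2 : Integrable (fun z => 2 * (γ z * f z + γ z * (f z - x z) ^ 2 / 8)) μ :=
    (i1.add (i3.div_const 8)).const_mul 2
  have j1 : Integrable (fun z => 2 * (γ z * (1 + η) * ((f z + x z) / 2) + e * (1 + √(1 / b)))) μ := by
    have : Integrable (fun z => (1 + η) * (γ z * f z + γ z * x z) + 2 * (e * (1 + √(1 / b)))) μ :=
      ((i1.add i2).const_mul (1 + η)).add (integrable_const _)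
    refine this.congr (Eventually.of_forall fun z => ?_)
    simp only
    ring
  have e2 : ∫ z, 2 * (γ z * f z + γ z * (f z - x z) ^ 2 / 8) ∂μ
      = 2 * ∫ z, γ z * f z ∂μ + (∫ z, γ z * (f z - x z) ^ 2 ∂μ) / 4 := by
    rw [integral_const_mul, integral_add i1 (i3.div_const 8), integral_div]
    ring
  have e1 : ∫ z, 2 * (γ z * (1 + η) * ((f z + x z) / 2) + e * (1 + √(1 / b))) ∂μ
      = (1 + η) * (∫ z, γ z * f z ∂μ + ∫ z, γ z * x z ∂μ)
          + 2 * e * (1 + √(1 / b)) * μ.real univ := by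
    have : ∀ z, 2 * (γ z * (1 + η) * ((f z + x z) / 2) + e * (1 + √(1 / b)))
        = (1 + η) * (γ z * f z + γ z * x z) + 2 * e * (1 + √(1 / b)) := fun z => by ring
    simp_rw [this]
    have j3 : Integrable (fun z => γ z * f z + γ z * x z) μ := i1.add i2
    rw [integral_add (j3.const_mul (1 + η)) (integrable_const _), integral_const_mul,
      integral_add i1 i2, integral_const, smul_eq_mul]
    ring
  rw [← e1, ← e2, ofReal_integral_eq_lintegral_ofReal j1 ?_,
    ofReal_integral_eq_lintegral_ofReal j2 ?_]
  · refine (le_lintegral_add _ _).trans ?_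
    rw [← lintegral_add_right' _ j1.aestronglyMeasurable.aemeasurable.ennreal_ofReal]
    refine lintegral_mono_ae ?_
    filter_upwards [H] with z hz
    obtain ⟨ha, hγ, hf, hx, hae, hc⟩ := hz
    exact negLogTerm_add_le_s8 ha hγ hf hx hη hb hae hc
  · filter_upwards [H] with z hz
    obtain ⟨ha, hγ, hf, hx, hae, hc⟩ := hz
    have := hf.1
    simp only [Pi.zero_apply]
    positivity
  · filter_upwards [H] with z hz
    obtain ⟨ha, hγ, hf, hx, hae, hc⟩ := hz
    have := hf.1
    have := hx.1
    simp only [Pi.zero_apply]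
    positivity

end DivergenceBound

section Mass

variable {M : ℝ} {g : ℝ → ℝ → ℝ} {g1 g2 : ℝ → ℝ}

lemma mem_obsTriangle_iff {p : ℝ × ℝ} :
    p ∈ obsTriangle M ↔ 0 ≤ p.1 ∧ p.1 < p.2 ∧ p.2 ≤ M := by
  simp only [obsTriangle, mem_inter_iff, mem_prod, mem_Icc, mem_ofPred_eq]
  constructor
  · rintro ⟨⟨⟨h1, h2⟩, h3, h4⟩, h5⟩; exact ⟨h1, h5, h4⟩
  · rintro ⟨h1, h5, h4⟩; exact ⟨⟨⟨h1, by linarith⟩, by linarith, h4⟩, h5⟩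

lemma integrable_density (hgzero : ∀ t u : ℝ, ¬(0 ≤ t ∧ t < u ∧ u ≤ M) → g t u = 0)
    (hgprob : (∫ p in {p : ℝ × ℝ | 0 ≤ p.1 ∧ p.1 < p.2 ∧ p.2 ≤ M}, g p.1 p.2) = 1) :
    Integrable (fun p : ℝ × ℝ => g p.1 p.2) ∧ ∫ p : ℝ × ℝ, g p.1 p.2 = 1 := by
  have h0 : ∀ p : ℝ × ℝ, p ∉ {p : ℝ × ℝ | 0 ≤ p.1 ∧ p.1 < p.2 ∧ p.2 ≤ M} → g p.1 p.2 = 0 :=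
    fun p hp => hgzero _ _ hp
  rw [setIntegral_eq_integral_of_forall_compl_eq_zero h0] at hgprob
  refine ⟨?_, hgprob⟩
  by_contra h
  rw [integral_undef h] at hgprob
  exact zero_ne_one hgprob

lemma first_marginal_eq (hgzero : ∀ t u : ℝ, ¬(0 ≤ t ∧ t < u ∧ u ≤ M) → g t u = 0)
    (hg1 : ∀ t, g1 t = ∫ u in t..M, g t u) {t : ℝ} (ht : t ∈ Icc (0:ℝ) M) :
    g1 t = ∫ u, g t u := by
  rw [hg1, intervalIntegral.integral_of_le ht.2]
  refine setIntegral_eq_integral_of_forall_compl_eq_zero fun u hu => hgzero _ _ fun h => hu ?_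
  exact ⟨h.2.1, h.2.2⟩

lemma second_marginal_eq (hgzero : ∀ t u : ℝ, ¬(0 ≤ t ∧ t < u ∧ u ≤ M) → g t u = 0)
    (hg2 : ∀ u, g2 u = ∫ t in (0:ℝ)..u, g t u) {u : ℝ} (hu : u ∈ Icc (0:ℝ) M) :
    g2 u = ∫ t, g t u := by
  rw [hg2, intervalIntegral.integral_of_le hu.1, ← integral_Icc_eq_integral_Ioc]
  refine setIntegral_eq_integral_of_forall_compl_eq_zero fun t ht => hgzero _ _ fun h => ht ?_
  exact ⟨h.1, h.2.1.le⟩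

lemma total_mass_eq_one (hgzero : ∀ t u : ℝ, ¬(0 ≤ t ∧ t < u ∧ u ≤ M) → g t u = 0)
    (hgprob : (∫ p in {p : ℝ × ℝ | 0 ≤ p.1 ∧ p.1 < p.2 ∧ p.2 ≤ M}, g p.1 p.2) = 1)
    (hg1 : ∀ t, g1 t = ∫ u in t..M, g t u)
    (hg2 : ∀ u, g2 u = ∫ t in (0:ℝ)..u, g t u)
    {F : ℝ → ℝ} (hFm : Measurable F) (hF : ∀ t, F t ∈ Icc (0:ℝ) 1) :
    (∫ t in Icc (0:ℝ) M, g1 t * F t) + (∫ t in Icc (0:ℝ) M, g2 t * (1 - F t))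
      + ∫ p in obsTriangle M, g p.1 p.2 * (F p.2 - F p.1) = 1 := by
  obtain ⟨hgi, hg⟩ := integrable_density hgzero hgprob
  have b1 : ∀ t, |F t| ≤ 1 := fun t => abs_le.mpr ⟨by linarith [(hF t).1], (hF t).2⟩
  have i1 : Integrable (fun p : ℝ × ℝ => g p.1 p.2 * F p.1) :=
    hgi.mul_bdd (hFm.comp measurable_fst).aestronglyMeasurable
      (Eventually.of_forall fun p => b1 p.1)
  have i1' : Integrable (fun p : ℝ × ℝ => g p.1 p.2 * F p.2) :=
    hgi.mul_bdd (hFm.comp measurable_snd).aestronglyMeasurable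
      (Eventually.of_forall fun p => b1 p.2)
  have i2 : Integrable (fun p : ℝ × ℝ => g p.1 p.2 * (1 - F p.2)) :=
    (hgi.sub i1').congr (Eventually.of_forall fun p => by simp only [Pi.sub_apply]; ring)
  have i3 : Integrable (fun p : ℝ × ℝ => g p.1 p.2 * (F p.2 - F p.1)) :=
    (i1'.sub i1).congr (Eventually.of_forall fun p => by simp only [Pi.sub_apply]; ring)
  have e1 : ∫ t in Icc (0:ℝ) M, g1 t * F t = ∫ p : ℝ × ℝ, g p.1 p.2 * F p.1 := by
    rw [Measure.volume_eq_prod] at i1 ⊢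
    rw [integral_prod _ i1]
    rw [← setIntegral_eq_integral_of_forall_compl_eq_zero (s := Icc (0:ℝ) M)
      (f := fun t => ∫ u, g t u * F t)]
    · refine setIntegral_congr_fun measurableSet_Icc fun t ht => ?_
      rw [integral_mul_const, first_marginal_eq hgzero hg1 ht]
    · intro t ht
      have : ∀ u, g t u = 0 := fun u => hgzero _ _ fun h => ht ⟨h.1, by linarith⟩
      simp [this]
  have e2 : ∫ t in Icc (0:ℝ) M, g2 t * (1 - F t) = ∫ p : ℝ × ℝ, g p.1 p.2 * (1 - F p.2) := by
    rw [Measure.volume_eq_prod] at i2 ⊢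
    rw [integral_prod_symm _ i2]
    rw [← setIntegral_eq_integral_of_forall_compl_eq_zero (s := Icc (0:ℝ) M)
      (f := fun u => ∫ t, g t u * (1 - F u))]
    · refine setIntegral_congr_fun measurableSet_Icc fun t ht => ?_
      rw [integral_mul_const, second_marginal_eq hgzero hg2 ht]
    · intro u hu
      have : ∀ t, g t u = 0 := fun t => hgzero _ _ fun h => hu ⟨by linarith, h.2.2⟩
      simp [this]
  have e3 : ∫ p in obsTriangle M, g p.1 p.2 * (F p.2 - F p.1)
      = ∫ p : ℝ × ℝ, g p.1 p.2 * (F p.2 - F p.1) := by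
    refine setIntegral_eq_integral_of_forall_compl_eq_zero fun p hp => ?_
    rw [hgzero _ _ fun h => hp (mem_obsTriangle_iff.mpr h), zero_mul]
  have i12 : Integrable (fun p : ℝ × ℝ => g p.1 p.2 * F p.1 + g p.1 p.2 * (1 - F p.2)) := i1.add i2
  rw [e1, e2, e3, ← integral_add i1 i2, ← integral_add i12 i3]
  refine Eq.trans ?_ hg
  congr 1
  ext p
  ring

end Mass

section Consistency

variable {M ε : ℝ} {g : ℝ → ℝ → ℝ} {g1 g2 : ℝ → ℝ}

lemma negLogLik_congr_s8 {a1 a2 : ℝ → ℝ} {a : ℝ → ℝ → ℝ} {F F' : ℝ → ℝ}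
    (h : EqOn F F' (Icc 0 M)) : negLogLik M a1 a2 a F = negLogLik M a1 a2 a F' := by
  unfold negLogLik
  congr 1
  · congr 1
    · exact setLIntegral_congr_fun measurableSet_Icc fun t ht => by simp only [h ht]
    · exact setLIntegral_congr_fun measurableSet_Icc fun t ht => by simp only [h ht]
  · exact setLIntegral_congr_fun (measurableSet_obsTriangle M) fun p hp => by
      simp only [h hp.1.1, h hp.1.2]

lemma first_marginal_nonneg (hg1 : ∀ t, g1 t = ∫ u in t..M, g t u) (hgnn : ∀ t u, 0 ≤ g t u)
    {t : ℝ} (ht : t ∈ Icc (0:ℝ) M) : 0 ≤ g1 t := by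
  rw [hg1]; exact intervalIntegral.integral_nonneg ht.2 fun u _ => hgnn t u

lemma second_marginal_nonneg (hg2 : ∀ u, g2 u = ∫ t in (0:ℝ)..u, g t u)
    (hgnn : ∀ t u, 0 ≤ g t u) {u : ℝ} (hu : u ∈ Icc (0:ℝ) M) : 0 ≤ g2 u := by
  rw [hg2]; exact intervalIntegral.integral_nonneg hu.1 fun t _ => hgnn t u

lemma add_ofReal_le_cancel {p1 p2 p3 q1 q2 q3 : ℝ≥0∞} {r1 r2 r3 s1 s2 s3 : ℝ}
    (hr1 : 0 ≤ r1) (hr2 : 0 ≤ r2) (hr3 : 0 ≤ r3) (hs1 : 0 ≤ s1) (hs2 : 0 ≤ s2) (hs3 : 0 ≤ s3)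
    (h1 : p1 + ENNReal.ofReal r1 ≤ q1 + ENNReal.ofReal s1)
    (h2 : p2 + ENNReal.ofReal r2 ≤ q2 + ENNReal.ofReal s2)
    (h3 : p3 + ENNReal.ofReal r3 ≤ q3 + ENNReal.ofReal s3)
    (hle : q1 + q2 + q3 ≤ p1 + p2 + p3) (hfin : p1 + p2 + p3 ≠ ⊤) :
    r1 + r2 + r3 ≤ s1 + s2 + s3 := by
  have K : (p1 + p2 + p3) + ENNReal.ofReal (r1 + r2 + r3)
      ≤ (p1 + p2 + p3) + ENNReal.ofReal (s1 + s2 + s3) := by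
    rw [ENNReal.ofReal_add (by positivity) hr3, ENNReal.ofReal_add hr1 hr2,
      ENNReal.ofReal_add (by positivity) hs3, ENNReal.ofReal_add hs1 hs2]
    calc _ = (p1 + ENNReal.ofReal r1) + (p2 + ENNReal.ofReal r2) + (p3 + ENNReal.ofReal r3) := by
          ring
      _ ≤ (q1 + ENNReal.ofReal s1) + (q2 + ENNReal.ofReal s2) + (q3 + ENNReal.ofReal s3) :=
          add_le_add (add_le_add h1 h2) h3
      _ = (q1 + q2 + q3)
          + (ENNReal.ofReal s1 + ENNReal.ofReal s2 + ENNReal.ofReal s3) := by ring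
      _ ≤ _ := by gcongr
  rwa [ENNReal.add_le_add_iff_left hfin, ENNReal.ofReal_le_ofReal_iff (by positivity)] at K

/-- Comparing the log-likelihood of `F` with that of a regular competitor `G` close to `F0`
bounds the weighted mean square distance between `F` and `F0`. -/
lemma weighted_sq_dist_le
    (hgzero : ∀ t u : ℝ, ¬(0 ≤ t ∧ t < u ∧ u ≤ M) → g t u = 0)
    (hgsep : ∀ t u : ℝ, u - t < ε → g t u = 0) (hgnn : ∀ t u : ℝ, 0 ≤ g t u)
    (hgprob : (∫ p in {p : ℝ × ℝ | 0 ≤ p.1 ∧ p.1 < p.2 ∧ p.2 ≤ M}, g p.1 p.2) = 1)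
    (hg1 : ∀ t, g1 t = ∫ u in t..M, g t u) (hg2 : ∀ u, g2 u = ∫ t in (0:ℝ)..u, g t u)
    (hg1cont : ContinuousOn g1 (Icc 0 M)) (hg2cont : ContinuousOn g2 (Icc 0 M))
    {F0 F G : ℝ → ℝ} (hF0m : Measurable F0) (hFm : Measurable F)
    (hF0 : ∀ t, F0 t ∈ Icc (0:ℝ) 1) (hF : ∀ t, F t ∈ Icc (0:ℝ) 1)
    (hF0mono : MonotoneOn F0 (Icc 0 M)) (hFmono : MonotoneOn F (Icc 0 M))
    {a1 a2 : ℝ → ℝ} {a : ℝ → ℝ → ℝ} (ha1 : ∀ t, 0 ≤ a1 t) (ha2 : ∀ t, 0 ≤ a2 t)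
    (ha : ∀ t u, 0 ≤ a t u) (hasep : ∀ t u, u - t < ε → a t u = 0)
    {e η b : ℝ} (hη : 0 < η) (hb : 0 < b) (he : 0 ≤ e)
    (hae1 : ∀ t ∈ Icc (0:ℝ) M, |a1 t - g1 t * F0 t| ≤ e)
    (hae2 : ∀ t ∈ Icc (0:ℝ) M, |a2 t - g2 t * (1 - F0 t)| ≤ e)
    (hae : ∀ t ∈ Icc (0:ℝ) M, ∀ u ∈ Icc (0:ℝ) M, |a t u - g t u * (F0 u - F0 t)| ≤ e)
    (hG1 : ∀ t ∈ Icc (0:ℝ) M, b ≤ G t ∧ G t ≤ 1 ∧ F0 t ≤ (1 + η) * G t)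
    (hG2 : ∀ t ∈ Icc (0:ℝ) M, b ≤ 1 - G t ∧ 1 - G t ≤ 1 ∧ 1 - F0 t ≤ (1 + η) * (1 - G t))
    (hG : ∀ t ∈ Icc (0:ℝ) M, ∀ u ∈ Icc (0:ℝ) M, ε ≤ u - t →
      b ≤ G u - G t ∧ G u - G t ≤ 1 ∧ F0 u - F0 t ≤ (1 + η) * (G u - G t))
    (hle : negLogLik M a1 a2 a F ≤ negLogLik M a1 a2 a G) :
    ∫ t in Icc (0:ℝ) M, (g1 t + g2 t) * (F0 t - F t) ^ 2
      ≤ 8 * (η + e * (1 + √(1 / b)) *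
        (2 * volume.real (Icc (0:ℝ) M) + volume.real (obsTriangle M))) := by
  have hT := measurableSet_obsTriangle M
  have : IsFiniteMeasure (volume.restrict (obsTriangle M)) :=
    isFiniteMeasure_restrict.mpr (volume_obsTriangle_lt_top M).ne
  have gi1 : Integrable g1 (volume.restrict (Icc 0 M)) := hg1cont.integrableOn_Icc
  have gi2 : Integrable g2 (volume.restrict (Icc 0 M)) := hg2cont.integrableOn_Icc
  have gi : Integrable (fun p : ℝ × ℝ => g p.1 p.2) (volume.restrict (obsTriangle M)) :=
    (integrable_density hgzero hgprob).1.restrict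
  have mF0 : AEStronglyMeasurable F0 (volume.restrict (Icc 0 M)) := hF0m.aestronglyMeasurable
  have mF : AEStronglyMeasurable F (volume.restrict (Icc 0 M)) := hFm.aestronglyMeasurable
  have mF0' : AEStronglyMeasurable (fun t => 1 - F0 t) (volume.restrict (Icc 0 M)) :=
    (measurable_const.sub hF0m).aestronglyMeasurable
  have mF' : AEStronglyMeasurable (fun t => 1 - F t) (volume.restrict (Icc 0 M)) :=
    (measurable_const.sub hFm).aestronglyMeasurable
  have mF0d : AEStronglyMeasurable (fun p : ℝ × ℝ => F0 p.2 - F0 p.1)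
      (volume.restrict (obsTriangle M)) :=
    ((hF0m.comp measurable_snd).sub (hF0m.comp measurable_fst)).aestronglyMeasurable
  have mFd : AEStronglyMeasurable (fun p : ℝ × ℝ => F p.2 - F p.1)
      (volume.restrict (obsTriangle M)) :=
    ((hFm.comp measurable_snd).sub (hFm.comp measurable_fst)).aestronglyMeasurable
  have hcompl : ∀ {x : ℝ}, x ∈ Icc (0:ℝ) 1 → 1 - x ∈ Icc (0:ℝ) 1 := fun hx =>
    ⟨by linarith [hx.2], by linarith [hx.1]⟩
  have hdiff : ∀ {H : ℝ → ℝ}, (∀ t, H t ∈ Icc (0:ℝ) 1) → MonotoneOn H (Icc 0 M) →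
      ∀ p ∈ obsTriangle M, H p.2 - H p.1 ∈ Icc (0:ℝ) 1 := fun hH hmono p hp =>
    ⟨sub_nonneg.mpr (hmono hp.1.1 hp.1.2 (le_of_lt hp.2)),
      by linarith [(hH p.2).2, (hH p.1).1]⟩
  have H1 : ∀ᵐ t ∂volume.restrict (Icc (0:ℝ) M), 0 ≤ a1 t ∧ 0 ≤ g1 t ∧ F0 t ∈ Icc (0:ℝ) 1 ∧
      F t ∈ Icc (0:ℝ) 1 ∧ |a1 t - g1 t * F0 t| ≤ e ∧
      ((a1 t = 0 ∧ g1 t = 0) ∨ (b ≤ G t ∧ G t ≤ 1 ∧ F0 t ≤ (1 + η) * G t)) :=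
    ae_restrict_of_forall_mem measurableSet_Icc fun t ht =>
      ⟨ha1 t, first_marginal_nonneg hg1 hgnn ht, hF0 t, hF t, hae1 t ht, Or.inr (hG1 t ht)⟩
  have H2 : ∀ᵐ t ∂volume.restrict (Icc (0:ℝ) M), 0 ≤ a2 t ∧ 0 ≤ g2 t ∧
      1 - F0 t ∈ Icc (0:ℝ) 1 ∧ 1 - F t ∈ Icc (0:ℝ) 1 ∧ |a2 t - g2 t * (1 - F0 t)| ≤ e ∧
      ((a2 t = 0 ∧ g2 t = 0) ∨
        (b ≤ 1 - G t ∧ 1 - G t ≤ 1 ∧ 1 - F0 t ≤ (1 + η) * (1 - G t))) :=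
    ae_restrict_of_forall_mem measurableSet_Icc fun t ht =>
      ⟨ha2 t, second_marginal_nonneg hg2 hgnn ht, hcompl (hF0 t), hcompl (hF t), hae2 t ht,
        Or.inr (hG2 t ht)⟩
  have H3 : ∀ᵐ p ∂volume.restrict (obsTriangle M), 0 ≤ a p.1 p.2 ∧ 0 ≤ g p.1 p.2 ∧
      F0 p.2 - F0 p.1 ∈ Icc (0:ℝ) 1 ∧ F p.2 - F p.1 ∈ Icc (0:ℝ) 1 ∧
      |a p.1 p.2 - g p.1 p.2 * (F0 p.2 - F0 p.1)| ≤ e ∧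
      ((a p.1 p.2 = 0 ∧ g p.1 p.2 = 0) ∨ (b ≤ G p.2 - G p.1 ∧ G p.2 - G p.1 ≤ 1 ∧
        F0 p.2 - F0 p.1 ≤ (1 + η) * (G p.2 - G p.1))) := by
    refine ae_restrict_of_forall_mem hT fun p hp => ⟨ha _ _, hgnn _ _, hdiff hF0 hF0mono p hp,
      hdiff hF hFmono p hp, hae _ hp.1.1 _ hp.1.2, ?_⟩
    rcases lt_or_ge (p.2 - p.1) ε with h | h
    · exact Or.inl ⟨hasep _ _ h, hgsep _ _ h⟩
    · exact Or.inr (hG _ hp.1.1 _ hp.1.2 h)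
  have hfin : negLogLik M a1 a2 a G ≠ ⊤ := by
    refine ENNReal.add_ne_top.mpr ⟨ENNReal.add_ne_top.mpr ⟨?_, ?_⟩, ?_⟩
    · exact lintegral_negLogTerm_ne_top hb gi1 (H1.mono fun t h =>
        ⟨h.2.1, h.2.2.1, h.2.2.2.2.1, h.2.2.2.2.2.imp_right fun h => h.1⟩)
    · exact lintegral_negLogTerm_ne_top hb gi2 (H2.mono fun t h =>
        ⟨h.2.1, h.2.2.1, h.2.2.2.2.1, h.2.2.2.2.2.imp_right fun h => h.1⟩)
    · change ∫⁻ p in obsTriangle M, negLogTerm (a p.1 p.2) (G p.2 - G p.1) ≠ ⊤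
      exact lintegral_negLogTerm_ne_top hb gi (H3.mono fun t h =>
        ⟨h.2.1, h.2.2.1, h.2.2.2.2.1, h.2.2.2.2.2.imp_right fun h => h.1⟩)
  have K1 := lintegral_negLogTerm_add_le hη hb he gi1 mF0 mF H1
  have K2 := lintegral_negLogTerm_add_le hη hb he gi2 mF0' mF' H2
  have K3 := lintegral_negLogTerm_add_le hη hb he gi mF0d mFd H3
  have S0 := total_mass_eq_one hgzero hgprob hg1 hg2 hF0m hF0
  have S := total_mass_eq_one hgzero hgprob hg1 hg2 hFm hF
  have d2 : ∫ t in Icc (0:ℝ) M, g2 t * (1 - F0 t - (1 - F t)) ^ 2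
      = ∫ t in Icc (0:ℝ) M, g2 t * (F0 t - F t) ^ 2 := by
    congr 1; ext t; ring
  have d12 : ∫ t in Icc (0:ℝ) M, (g1 t + g2 t) * (F0 t - F t) ^ 2
      = (∫ t in Icc (0:ℝ) M, g1 t * (F0 t - F t) ^ 2)
        + ∫ t in Icc (0:ℝ) M, g2 t * (F0 t - F t) ^ 2 := by
    have hr : ∀ᵐ t ∂volume.restrict (Icc (0:ℝ) M), F0 t ∈ Icc (0:ℝ) 1 ∧ F t ∈ Icc (0:ℝ) 1 :=
      Eventually.of_forall fun t => ⟨hF0 t, hF t⟩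
    rw [← integral_add (integrable_divergence_terms gi1 mF0 mF hr).2.2
      (integrable_divergence_terms gi2 mF0 mF hr).2.2]
    congr 1; ext t; ring
  have n1 : 0 ≤ ∫ t in Icc (0:ℝ) M, g1 t * F0 t := integral_nonneg_of_ae <| H1.mono fun t h =>
    mul_nonneg h.2.1 h.2.2.1.1
  have n2 : 0 ≤ ∫ t in Icc (0:ℝ) M, g2 t * (1 - F0 t) := integral_nonneg_of_ae <|
    H2.mono fun t h => mul_nonneg h.2.1 h.2.2.1.1
  have n3 : 0 ≤ ∫ p in obsTriangle M, g p.1 p.2 * (F0 p.2 - F0 p.1) := integral_nonneg_of_ae <|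
    H3.mono fun t h => mul_nonneg h.2.1 h.2.2.1.1
  have m1 : 0 ≤ ∫ t in Icc (0:ℝ) M, g1 t * F t := integral_nonneg_of_ae <| H1.mono fun t h =>
    mul_nonneg h.2.1 h.2.2.2.1.1
  have m2 : 0 ≤ ∫ t in Icc (0:ℝ) M, g2 t * (1 - F t) := integral_nonneg_of_ae <|
    H2.mono fun t h => mul_nonneg h.2.1 h.2.2.2.1.1
  have m3 : 0 ≤ ∫ p in obsTriangle M, g p.1 p.2 * (F p.2 - F p.1) := integral_nonneg_of_ae <|
    H3.mono fun t h => mul_nonneg h.2.1 h.2.2.2.1.1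
  have q1 : 0 ≤ ∫ t in Icc (0:ℝ) M, g1 t * (F0 t - F t) ^ 2 := integral_nonneg_of_ae <|
    H1.mono fun t h => mul_nonneg h.2.1 (sq_nonneg _)
  have q2 : 0 ≤ ∫ t in Icc (0:ℝ) M, g2 t * (F0 t - F t) ^ 2 := integral_nonneg_of_ae <|
    H2.mono fun t h => mul_nonneg h.2.1 (sq_nonneg _)
  have q3 : 0 ≤ ∫ p in obsTriangle M, g p.1 p.2 * (F0 p.2 - F0 p.1 - (F p.2 - F p.1)) ^ 2 :=
    integral_nonneg_of_ae <| H3.mono fun t h => mul_nonneg h.2.1 (sq_nonneg _)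
  simp only [measureReal_restrict_apply_univ] at K1 K2 K3
  rw [d2] at K2
  rw [d12]
  have hs := Real.sqrt_nonneg (1 / b)
  have v1 : 0 ≤ volume.real (Icc (0:ℝ) M) := measureReal_nonneg
  have v2 : 0 ≤ volume.real (obsTriangle M) := measureReal_nonneg
  have hη' : 0 ≤ 1 + η := by linarith
  have K := add_ofReal_le_cancel (by positivity) (by positivity) (by positivity)
    (by positivity) (by positivity) (by positivity) K1 K2 K3 hle hfin
  have SS := congrArg₂ (fun z w => (1 + η) * (z + w)) S0 S
  beta_reduce at SS
  linarith

/-- Clamping the argument to `[0,M]` turns a function on `[0,M]` into one on `ℝ`. -/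
def clampExtend (M : ℝ) (F : ℝ → ℝ) (t : ℝ) : ℝ := F (max 0 (min M t))

lemma clamp_mem (hM : 0 < M) (t : ℝ) : max 0 (min M t) ∈ Icc (0:ℝ) M :=
  ⟨le_max_left _ _, max_le hM.le (min_le_left _ _)⟩

lemma clampExtend_of_mem {F : ℝ → ℝ} {t : ℝ} (ht : t ∈ Icc (0:ℝ) M) :
    clampExtend M F t = F t := by
  simp [clampExtend, min_eq_right ht.2, max_eq_right ht.1]

lemma clampExtend_monotone (hM : 0 < M) {F : ℝ → ℝ} (hF : MonotoneOn F (Icc 0 M)) :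
    Monotone (clampExtend M F) := fun _ _ h =>
  hF (clamp_mem hM _) (clamp_mem hM _) (max_le_max le_rfl (min_le_min le_rfl h))

/-- Mixing `F0` with the constant `1/2` gives a competitor bounded away from `0` and `1`. -/
def shrink (η : ℝ) (F0 : ℝ → ℝ) (t : ℝ) : ℝ := (F0 t + η / 2) / (1 + η)

lemma isSubDist_shrink {η : ℝ} (hη : 0 < η) {F0 : ℝ → ℝ} (hcont : ContinuousOn F0 (Icc 0 M))
    (hmono : MonotoneOn F0 (Icc 0 M)) (hF0 : ∀ t ∈ Icc (0:ℝ) M, F0 t ∈ Icc (0:ℝ) 1) :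
    IsSubDist M (shrink η F0) := by
  have hη' : 0 < 1 + η := by linarith
  refine ⟨fun s hs t ht h => ?_, fun t ht => ?_, fun t ht => ?_⟩
  · unfold shrink
    have := hmono hs ht h
    gcongr
  · obtain ⟨h1, h2⟩ := hF0 t ht
    unfold shrink
    constructor
    · positivity
    · rw [div_le_one hη']; linarith
  · have h : ContinuousWithinAt F0 (Ici t) t :=
      (hcont t ⟨ht.1, ht.2.le⟩).mono_of_mem_nhdsWithin
        (mem_of_superset (Icc_mem_nhdsGE ht.2) (Icc_subset_Icc_left ht.1))
    exact (h.add continuousWithinAt_const).div_const _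

lemma weighted_sq_dist_eventually_le (hM : 0 < M)
    (hgzero : ∀ t u : ℝ, ¬(0 ≤ t ∧ t < u ∧ u ≤ M) → g t u = 0)
    (hgsep : ∀ t u : ℝ, u - t < ε → g t u = 0) (hgnn : ∀ t u : ℝ, 0 ≤ g t u)
    (hgprob : (∫ p in {p : ℝ × ℝ | 0 ≤ p.1 ∧ p.1 < p.2 ∧ p.2 ≤ M}, g p.1 p.2) = 1)
    (hg1 : ∀ t, g1 t = ∫ u in t..M, g t u) (hg2 : ∀ u, g2 u = ∫ t in (0:ℝ)..u, g t u)
    (hg1cont : ContinuousOn g1 (Icc 0 M)) (hg2cont : ContinuousOn g2 (Icc 0 M))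
    {F0 : ℝ → ℝ} (hF0cont : ContinuousOn F0 (Icc 0 M)) (hF0mono : MonotoneOn F0 (Icc 0 M))
    (hF0 : ∀ t ∈ Icc (0:ℝ) M, F0 t ∈ Icc (0:ℝ) 1)
    {c : ℝ} (hc : 0 < c)
    (hF0sep : ∀ t u, t ∈ Icc (0:ℝ) M → u ∈ Icc (0:ℝ) M → ε ≤ u - t → c ≤ F0 u - F0 t)
    {hn1 hn2 : ℕ → ℝ → ℝ} {hn : ℕ → ℝ → ℝ → ℝ}
    (hn1nn : ∀ n t, 0 ≤ hn1 n t) (hn2nn : ∀ n t, 0 ≤ hn2 n t)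
    (hnnn : ∀ n t u, 0 ≤ hn n t u) (hnsep : ∀ n t u, u - t < ε → hn n t u = 0)
    (hconv1 : TendstoUniformlyOn (fun n t => hn1 n t) (fun t => F0 t * g1 t)
      atTop (Icc 0 M))
    (hconv2 : TendstoUniformlyOn (fun n t => hn2 n t) (fun t => (1 - F0 t) * g2 t)
      atTop (Icc 0 M))
    (hconv : TendstoUniformlyOn (fun n (p : ℝ × ℝ) => hn n p.1 p.2)
      (fun p => (F0 p.2 - F0 p.1) * g p.1 p.2) atTop (Icc 0 M ×ˢ Icc 0 M))
    {Fhat : ℕ → ℝ → ℝ} (hFhatsub : ∀ n, IsSubDist M (Fhat n))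
    (hFhatmax : ∀ n, MaximizesEll M (hn1 n) (hn2 n) (hn n) (Fhat n))
    {δ : ℝ} (hδ : 0 < δ) :
    ∀ᶠ n in atTop, ∫ t in Icc (0:ℝ) M,
      (g1 t + g2 t) * (clampExtend M F0 t - clampExtend M (Fhat n) t) ^ 2 ≤ δ := by
  set η : ℝ := δ / 16 with hηdef
  have hη : 0 < η := by positivity
  have hη' : 0 < 1 + η := by linarith
  set b : ℝ := min (η / 2 / (1 + η)) (c / (1 + η)) with hbdef
  have hb : 0 < b := lt_min (by positivity) (by positivity)
  set V : ℝ := 2 * volume.real (Icc (0:ℝ) M) + volume.real (obsTriangle M) with hV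
  have hV0 : 0 ≤ V := by positivity
  set D : ℝ := (1 + √(1 / b)) * V with hD
  have hD0 : 0 ≤ D := by positivity
  set e : ℝ := η / (D + 1) with hedef
  have he : 0 < e := by positivity
  have heD : e * D ≤ η := by
    rw [hedef, div_mul_eq_mul_div, div_le_iff₀ (by linarith)]
    nlinarith
  filter_upwards [Metric.tendstoUniformlyOn_iff.mp hconv1 e he,
    Metric.tendstoUniformlyOn_iff.mp hconv2 e he,
    Metric.tendstoUniformlyOn_iff.mp hconv e he] with n c1 c2 c3
  have E0 : ∀ t ∈ Icc (0:ℝ) M, clampExtend M F0 t = F0 t := fun t => clampExtend_of_mem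
  have EF : EqOn (clampExtend M (Fhat n)) (Fhat n) (Icc 0 M) := fun t => clampExtend_of_mem
  have mono0 := clampExtend_monotone hM hF0mono
  have monoF := clampExtend_monotone hM (hFhatsub n).1
  have hη1 : ∀ t, (1 + η) * shrink η F0 t = F0 t + η / 2 := fun t => by
    unfold shrink; field_simp
  have hsub : ∀ t u, (1 + η) * (shrink η F0 u - shrink η F0 t) = F0 u - F0 t := fun t u => by
    rw [mul_sub, hη1, hη1]; ring
  have hb1 : (1 + η) * b ≤ η / 2 := by
    rw [mul_comm, ← le_div_iff₀ hη']; exact min_le_left _ _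
  have hb2 : (1 + η) * b ≤ c := by
    rw [mul_comm, ← le_div_iff₀ hη']; exact min_le_right _ _
  have hG := isSubDist_shrink hη hF0cont hF0mono hF0
  have key := weighted_sq_dist_le (G := shrink η F0) (F0 := clampExtend M F0)
    (F := clampExtend M (Fhat n)) (a1 := hn1 n) (a2 := hn2 n) (a := hn n) (b := b) (e := e)
    hgzero hgsep hgnn hgprob hg1 hg2 hg1cont hg2cont mono0.measurable monoF.measurable
    (fun t => hF0 _ (clamp_mem hM t)) (fun t => (hFhatsub n).2.1 _ (clamp_mem hM t))
    (mono0.monotoneOn _) (monoF.monotoneOn _) (hn1nn n) (hn2nn n) (hnnn n) (hnsep n) hη hb he.le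
    ?_ ?_ ?_ ?_ ?_ ?_ ?_
  · refine key.trans ?_
    rw [mul_assoc e]
    change 8 * (η + e * D) ≤ δ
    linarith
  · intro t ht
    rw [E0 t ht, abs_sub_comm, mul_comm (g1 t)]
    exact (c1 t ht).le
  · intro t ht
    rw [E0 t ht, abs_sub_comm, mul_comm (g2 t)]
    exact (c2 t ht).le
  · intro t ht u hu
    rw [E0 t ht, E0 u hu, abs_sub_comm, mul_comm (g t u)]
    exact (c3 (t, u) ⟨ht, hu⟩).le
  · intro t ht
    rw [E0 t ht, hη1]
    refine ⟨?_, (hG.2.1 t ht).2, by linarith⟩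
    refine le_of_mul_le_mul_left ?_ hη'
    rw [hη1]; linarith [(hF0 t ht).1]
  · intro t ht
    rw [E0 t ht, mul_sub, hη1]
    refine ⟨?_, by linarith [(hG.2.1 t ht).1], by linarith⟩
    refine le_of_mul_le_mul_left ?_ hη'
    rw [mul_sub, hη1]; linarith [(hF0 t ht).2]
  · intro t ht u hu htu
    rw [E0 t ht, E0 u hu, hsub]
    refine ⟨?_, by linarith [(hG.2.1 t ht).1, (hG.2.1 u hu).2], le_rfl⟩
    refine le_of_mul_le_mul_left ?_ hη'
    rw [hsub]; linarith [hF0sep t u ht hu htu]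
  · rw [negLogLik_congr_s8 EF]
    exact hFhatmax n _ hG

/-- A nonnegative integral over `[0,M]` dominates length times a lower bound on a subinterval. -/
lemma mul_le_setIntegral_of_le_on_subinterval {w : ℝ → ℝ} {x y k : ℝ}
    (hw : IntegrableOn w (Icc 0 M)) (hw0 : ∀ t ∈ Icc (0:ℝ) M, 0 ≤ w t) (hx : 0 ≤ x) (hxy : x ≤ y)
    (hy : y ≤ M) (hk : ∀ t ∈ Icc x y, k ≤ w t) :
    (y - x) * k ≤ ∫ t in Icc (0:ℝ) M, w t := by
  have hsub : Icc x y ⊆ Icc 0 M := Icc_subset_Icc hx hy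
  calc (y - x) * k = ∫ _ in Icc x y, k := by
        rw [setIntegral_const, Real.volume_real_Icc_of_le hxy, smul_eq_mul]
    _ ≤ ∫ t in Icc x y, w t :=
        setIntegral_mono_on (integrableOn_const (by simp)) (hw.mono_set hsub) measurableSet_Icc hk
    _ ≤ _ := setIntegral_mono_set hw (ae_restrict_of_forall_mem measurableSet_Icc hw0)
        hsub.eventuallyLE

/-- A monotone function which is close to a uniformly continuous one in weighted mean square
is pointwise close to it, from above off the right end and from below off the left end. -/
lemma pointwise_close_of_weighted_sq_dist {w F0 F : ℝ → ℝ} {m r δ : ℝ}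
    (hm : 0 < m) (hr : 0 < r) (hδ : 0 < δ) (hw : ContinuousOn w (Icc 0 M))
    (hwm : ∀ t ∈ Icc (0:ℝ) M, m ≤ w t)
    (hF0m : Monotone F0) (hFm : Monotone F)
    (hF0 : ∀ t, F0 t ∈ Icc (0:ℝ) 1) (hF : ∀ t, F t ∈ Icc (0:ℝ) 1)
    (hunif : ∀ s ∈ Icc (0:ℝ) M, ∀ t ∈ Icc (0:ℝ) M, |s - t| ≤ r → |F0 s - F0 t| < δ / 2)
    (hint : ∫ t in Icc (0:ℝ) M, w t * (F0 t - F t) ^ 2 < r * (m * (δ / 2) ^ 2)) :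
    (∀ x, 0 ≤ x → x + r ≤ M → F x < F0 x + δ) ∧ (∀ x, r ≤ x → x ≤ M → F0 x - δ < F x) := by
  have hi : IntegrableOn (fun t => w t * (F0 t - F t) ^ 2) (Icc 0 M) :=
    (integrable_divergence_terms (μ := volume.restrict (Icc 0 M)) hw.integrableOn_Icc
      hF0m.measurable.aestronglyMeasurable hFm.measurable.aestronglyMeasurable
      (Eventually.of_forall fun t => ⟨hF0 t, hF t⟩)).2.2
  have h0 : ∀ t ∈ Icc (0:ℝ) M, 0 ≤ w t * (F0 t - F t) ^ 2 := fun t ht =>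
    mul_nonneg (hm.le.trans (hwm t ht)) (sq_nonneg _)
  constructor
  · intro x hx hxr
    by_contra! h
    have := mul_le_setIntegral_of_le_on_subinterval (k := m * (δ / 2) ^ 2) hi h0 hx
      (by linarith : x ≤ x + r) hxr fun t ht => ?_
    · rw [add_sub_cancel_left] at this; linarith
    have htM : t ∈ Icc (0:ℝ) M := ⟨hx.trans ht.1, ht.2.trans hxr⟩
    have h1 := hunif t htM x ⟨hx, by linarith⟩ (abs_le.mpr ⟨by linarith [ht.1], by linarith [ht.2]⟩)
    have h2 := hFm ht.1
    have h3 : δ / 2 ≤ F t - F0 t := by linarith [(abs_lt.mp h1).2]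
    refine mul_le_mul (hwm t htM) ?_ (by positivity) (hm.le.trans (hwm t htM))
    nlinarith
  · intro x hxr hx
    by_contra! h
    have := mul_le_setIntegral_of_le_on_subinterval (k := m * (δ / 2) ^ 2) hi h0
      (by linarith : 0 ≤ x - r) (by linarith : x - r ≤ x) hx fun t ht => ?_
    · rw [sub_sub_cancel] at this; linarith
    have htM : t ∈ Icc (0:ℝ) M := ⟨by linarith [ht.1], ht.2.trans hx⟩
    have h1 := hunif t htM x ⟨by linarith, hx⟩ (abs_le.mpr ⟨by linarith [ht.1], by linarith [ht.2]⟩)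
    have h2 := hFm ht.2
    have h3 : δ / 2 ≤ F0 t - F t := by linarith [(abs_lt.mp h1).1]
    refine mul_le_mul (hwm t htM) ?_ (by positivity) (hm.le.trans (hwm t htM))
    nlinarith

end Consistency

/-- consistency of the maximum smoothed likelihood estimator when the
plugged-in densities converge uniformly to the true (sub)densities. -/
theorem stmt_8
    (M ε : ℝ) (hM : 0 < M) (hε : ε ∈ Ioc (0:ℝ) (M / 2))
    -- the true distribution function F0, with support [0,M]
    (F0 : ℝ → ℝ) (hF0cont : ContinuousOn F0 (Icc 0 M))
    (hF0mono : MonotoneOn F0 (Icc 0 M)) (hF00 : F0 0 = 0) (hF0M : F0 M = 1)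
    (c : ℝ) (hc : 0 < c)
    (hF0sep : ∀ t u, t ∈ Icc (0:ℝ) M → u ∈ Icc (0:ℝ) M → ε ≤ u - t → c ≤ F0 u - F0 t)
    -- the observation density g and its marginals g1, g2
    (g : ℝ → ℝ → ℝ) (g1 g2 : ℝ → ℝ)
    (hgcont : ContinuousOn (fun p : ℝ × ℝ => g p.1 p.2)
      {p : ℝ × ℝ | 0 ≤ p.1 ∧ p.1 < p.2 ∧ p.2 ≤ M})
    (hgzero : ∀ t u : ℝ, ¬(0 ≤ t ∧ t < u ∧ u ≤ M) → g t u = 0)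
    (hgsep : ∀ t u : ℝ, u - t < ε → g t u = 0)
    (hgnn : ∀ t u : ℝ, 0 ≤ g t u)
    (hgprob : (∫ p in {p : ℝ × ℝ | 0 ≤ p.1 ∧ p.1 < p.2 ∧ p.2 ≤ M}, g p.1 p.2) = 1)
    (hg1 : ∀ t, g1 t = ∫ u in t..M, g t u)
    (hg2 : ∀ u, g2 u = ∫ t in (0:ℝ)..u, g t u)
    (hg1cont : ContinuousOn g1 (Icc 0 M)) (hg2cont : ContinuousOn g2 (Icc 0 M))
    (hgpos : ∀ x ∈ Icc (0:ℝ) M, 0 < g1 x + g2 x)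
    -- extra positivity of g strictly above the diagonal band
    (hgpos2 : ∀ t u : ℝ, 0 ≤ t → t < u → u ≤ M → ε < u - t → 0 < g t u)
    -- the sequences of plugged-in densities
    (hn1 hn2 : ℕ → ℝ → ℝ) (hn : ℕ → ℝ → ℝ → ℝ)
    (hn1cont : ∀ n, ContinuousOn (hn1 n) (Icc 0 M))
    (hn2cont : ∀ n, ContinuousOn (hn2 n) (Icc 0 M))
    (hncont : ∀ n, ContinuousOn (fun p : ℝ × ℝ => hn n p.1 p.2) (Icc 0 M ×ˢ Icc 0 M))
    (hn1nn : ∀ n t, 0 ≤ hn1 n t) (hn2nn : ∀ n t, 0 ≤ hn2 n t)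
    (hnnn : ∀ n t u, 0 ≤ hn n t u)
    (hnsep : ∀ n t u, u - t < ε → hn n t u = 0)
    (hconv1 : TendstoUniformlyOn (fun n t => hn1 n t) (fun t => F0 t * g1 t)
      atTop (Icc 0 M))
    (hconv2 : TendstoUniformlyOn (fun n t => hn2 n t) (fun t => (1 - F0 t) * g2 t)
      atTop (Icc 0 M))
    (hconv : TendstoUniformlyOn (fun n (p : ℝ × ℝ) => hn n p.1 p.2)
      (fun p => (F0 p.2 - F0 p.1) * g p.1 p.2) atTop (Icc 0 M ×ˢ Icc 0 M))
    -- the maximizers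
    (Fhat : ℕ → ℝ → ℝ)
    (hFhatsub : ∀ n, IsSubDist M (Fhat n))
    (hFhatfin : ∀ n, negLogLik M (hn1 n) (hn2 n) (hn n) (Fhat n) ≠ ⊤)
    (hFhatmax : ∀ n, MaximizesEll M (hn1 n) (hn2 n) (hn n) (Fhat n)) :
    (∀ t ∈ Ico (0:ℝ) M, Tendsto (fun n => Fhat n t) atTop (𝓝 (F0 t))) ∧
      ∀ a b : ℝ, 0 < a → a ≤ b → b < M →
        TendstoUniformlyOn (fun n t => Fhat n t) F0 atTop (Icc a b) := by
  have hF0 : ∀ t ∈ Icc (0:ℝ) M, F0 t ∈ Icc (0:ℝ) 1 := fun t ht =>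
    ⟨hF00 ▸ hF0mono ⟨le_rfl, hM.le⟩ ht ht.1, hF0M ▸ hF0mono ht ⟨hM.le, le_rfl⟩ ht.2⟩
  obtain ⟨x0, hx0, hmin⟩ := isCompact_Icc.exists_isMinOn (nonempty_Icc.mpr hM.le)
    (hg1cont.add hg2cont)
  have hm := hgpos x0 hx0
  set m := g1 x0 + g2 x0
  have close : ∀ ρ > 0, ρ ≤ M → ∀ δ > 0, ∀ᶠ n in atTop,
      (∀ x, 0 ≤ x → x + ρ ≤ M → Fhat n x < F0 x + δ) ∧
      (∀ x, ρ ≤ x → x ≤ M → F0 x - δ < Fhat n x) := by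
    intro ρ hρ hρM δ hδ
    obtain ⟨r0, hr0, hunif⟩ := Metric.uniformContinuousOn_iff.mp
      (isCompact_Icc.uniformContinuousOn_of_continuous hF0cont) (δ / 2) (by positivity)
    set r := min ρ (r0 / 2)
    have hr : 0 < r := lt_min hρ (by positivity)
    have hrr0 : r < r0 := (min_le_right _ _).trans_lt (by linarith)
    have hrρ : r ≤ ρ := min_le_left _ _
    filter_upwards [weighted_sq_dist_eventually_le hM hgzero hgsep hgnn hgprob hg1 hg2 hg1cont
      hg2cont hF0cont hF0mono hF0 hc hF0sep hn1nn hn2nn hnnn hnsep hconv1 hconv2 hconv hFhatsub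
      hFhatmax (δ := r * (m * (δ / 2) ^ 2) / 2) (by positivity)] with n h
    have hlt : r * (m * (δ / 2) ^ 2) / 2 < r * (m * (δ / 2) ^ 2) := half_lt_self (by positivity)
    obtain ⟨h1, h2⟩ := pointwise_close_of_weighted_sq_dist hm hr hδ (hg1cont.add hg2cont)
      (fun t ht => hmin ht) (clampExtend_monotone hM hF0mono)
      (clampExtend_monotone hM (hFhatsub n).1) (fun t => hF0 _ (clamp_mem hM t))
      (fun t => (hFhatsub n).2.1 _ (clamp_mem hM t))
      (fun s hs t ht hst => by
        rw [clampExtend_of_mem hs, clampExtend_of_mem ht]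
        exact hunif s hs t ht (hst.trans_lt hrr0))
      (h.trans_lt hlt)
    constructor
    · intro x hx hxM
      have hx' : x ∈ Icc (0:ℝ) M := ⟨hx, by linarith⟩
      have := h1 x hx (by linarith)
      rwa [clampExtend_of_mem hx', clampExtend_of_mem hx'] at this
    · intro x hx hxM
      have hx' : x ∈ Icc (0:ℝ) M := ⟨by linarith, hxM⟩
      have := h2 x (by linarith) hxM
      rwa [clampExtend_of_mem hx', clampExtend_of_mem hx'] at this
  have unif : ∀ a b : ℝ, 0 < a → a ≤ b → b < M →
      TendstoUniformlyOn (fun n t => Fhat n t) F0 atTop (Icc a b) := by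
    intro a b ha hab hbM
    rw [Metric.tendstoUniformlyOn_iff]
    intro δ hδ
    filter_upwards [close (min a (M - b)) (lt_min ha (by linarith))
      ((min_le_left _ _).trans (by linarith)) δ hδ] with n ⟨h1, h2⟩ x hx
    have k1 := h1 x (ha.le.trans hx.1) (by linarith [min_le_right a (M - b), hx.2])
    have k2 := h2 x ((min_le_left _ _).trans hx.1) (hx.2.trans hbM.le)
    rw [Real.dist_eq, abs_lt]
    constructor <;> linarith
  refine ⟨fun t ht => ?_, unif⟩
  rcases ht.1.eq_or_lt with rfl | ht0
  · rw [Metric.tendsto_nhds]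
    intro δ hδ
    filter_upwards [close M hM le_rfl δ hδ] with n ⟨h1, _⟩
    have k1 := h1 0 le_rfl (by linarith)
    have k2 := ((hFhatsub n).2.1 0 ⟨le_rfl, hM.le⟩).1
    rw [Real.dist_eq, abs_lt]
    constructor <;> linarith
  · exact (unif t t ht0 le_rfl ht.2).tendsto_at ⟨le_rfl, le_rfl⟩
end
end

section
/- Suppose A ∈ C[0,M] satisfies, for every t ∈ [0,M], −(h01(t)+h02(t))A(t) + (1−2F0(t))A(t){∫_0^t h0(v,t)/(F0(t)−F0(v)) dv − ∫_t^M h0(t,u)/(F0(u)−F0(t)) du} − F0(t)(1−F0(t)){∫_0^t h0(u,t)(A(t)−A(u))/(F0(t)−F0(u))² du + ∫_t^M h0(t,u)(A(t)−A(u))/(F0(u)−F0(t))² du} = 0. Then A(t) = 0 for all t ∈ [0,M]. (That is, the linearization of the equation φ = 0 at (h01,h02,h0,F0) is injective on C[0,M].) -/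
open MeasureTheory Set Filter
open scoped ENNReal NNReal Topology

noncomputable section

/-- The function `φ(t; h1, h2, h, F)` of the integral equation. -/
def phiIC (M : ℝ) (h1 h2 : ℝ → ℝ) (h : ℝ → ℝ → ℝ) (F : ℝ → ℝ) (t : ℝ) : ℝ :=
  h1 t * (1 - F t) - h2 t * F t +
    F t * (1 - F t) *
      ((∫ v in (0:ℝ)..t, h v t / (F t - F v)) - ∫ u in t..M, h t u / (F u - F t))

/-- The norm `‖h‖_S` on continuous functions supported on
`S = {(x,y) : 0 ≤ x, x + ε ≤ y ≤ M}`. -/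
def normS (M ε : ℝ) (h : ℝ → ℝ → ℝ) : ℝ :=
  ⨆ t ∈ Icc (0:ℝ) M, ((∫ u in Icc 0 (t - ε), |h u t|) + ∫ u in Icc (t + ε) M, |h t u|)

/-- First partial derivative of a bivariate function. -/
def pderiv1 (h : ℝ → ℝ → ℝ) (t u : ℝ) : ℝ := deriv (fun s => h s u) t

/-- Second partial derivative (w.r.t. the second variable) of a bivariate function. -/
def pderiv2 (h : ℝ → ℝ → ℝ) (t u : ℝ) : ℝ := deriv (fun s => h t s) u

/-- Where `d` vanishes only if `k` does, the factor `d` cancels under the integral. -/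
theorem intervalIntegral_mul_div_cancel {a b : ℝ} {d k : ℝ → ℝ}
    (h : ∀ x, x ∈ Set.uIcc a b → d x = 0 → k x = 0) :
    ∫ x in a..b, d x * k x / d x = ∫ x in a..b, k x := by
  refine intervalIntegral.integral_congr fun x hx => ?_
  by_cases hd : d x = 0
  · simp [hd, h x hx hd]
  · exact mul_div_cancel_left₀ (k x) hd

/-- Maximum principle: a weighted integral of nonnegative increments is nonnegative. -/
theorem intervalIntegral_weighted_nonneg {a b : ℝ} (hab : a ≤ b) {d k w : ℝ → ℝ}
    (hd : ∀ x ∈ Set.Icc a b, 0 ≤ d x) (hk : ∀ x, 0 ≤ k x)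
    (hw : ∀ x ∈ Set.Icc a b, 0 ≤ w x) :
    0 ≤ ∫ x in a..b, d x * k x * w x / d x ^ 2 :=
  intervalIntegral.integral_nonneg hab fun x hx =>
    div_nonneg (mul_nonneg (mul_nonneg (hd x hx) (hk x)) (hw x hx)) (sq_nonneg _)

theorem intervalIntegral_weighted_nonpos {a b : ℝ} (hab : a ≤ b) {d k w : ℝ → ℝ}
    (hd : ∀ x ∈ Set.Icc a b, 0 ≤ d x) (hk : ∀ x, 0 ≤ k x)
    (hw : ∀ x ∈ Set.Icc a b, w x ≤ 0) :
    ∫ x in a..b, d x * k x * w x / d x ^ 2 ≤ 0 := by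
  have h := intervalIntegral_weighted_nonneg hab hd hk
    (w := fun x => -w x) fun x hx => neg_nonneg.2 (hw x hx)
  simpa only [mul_neg, neg_div, intervalIntegral.integral_neg, Left.nonneg_neg_iff] using h

/-- the linearization of `φ = 0` at `(h01, h02, h0, F0)` is injective
on `C[0,M]`. Here `h01(t) = F0(t)g1(t)`, `h02(u) = (1-F0(u))g2(u)` and
`h0(t,u) = (F0(u)-F0(t))g(t,u)`. -/
theorem stmt_10
    (M ε : ℝ) (hM : 0 < M) (hε : ε ∈ Ioc (0:ℝ) (M / 2))
    (F0 : ℝ → ℝ) (hF0cont : ContinuousOn F0 (Icc 0 M))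
    (hF0mono : MonotoneOn F0 (Icc 0 M)) (hF00 : F0 0 = 0) (hF0M : F0 M = 1)
    (c : ℝ) (hc : 0 < c)
    (hF0sep : ∀ t u, t ∈ Icc (0:ℝ) M → u ∈ Icc (0:ℝ) M → ε ≤ u - t → c ≤ F0 u - F0 t)
    (g : ℝ → ℝ → ℝ) (g1 g2 : ℝ → ℝ)
    (hgcont : ContinuousOn (fun p : ℝ × ℝ => g p.1 p.2)
      {p : ℝ × ℝ | 0 ≤ p.1 ∧ p.1 < p.2 ∧ p.2 ≤ M})
    (hgzero : ∀ t u : ℝ, ¬(0 ≤ t ∧ t < u ∧ u ≤ M) → g t u = 0)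
    (hgsep : ∀ t u : ℝ, u - t < ε → g t u = 0)
    (hgnn : ∀ t u : ℝ, 0 ≤ g t u)
    (hgprob : (∫ p in {p : ℝ × ℝ | 0 ≤ p.1 ∧ p.1 < p.2 ∧ p.2 ≤ M}, g p.1 p.2) = 1)
    (hg1 : ∀ t, g1 t = ∫ u in t..M, g t u)
    (hg2 : ∀ u, g2 u = ∫ t in (0:ℝ)..u, g t u)
    (hg1cont : ContinuousOn g1 (Icc 0 M)) (hg2cont : ContinuousOn g2 (Icc 0 M))
    (hgpos : ∀ t ∈ Icc (0:ℝ) M, 0 < g1 t * (1 - F0 t) + g2 t * F0 t)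
    (A : ℝ → ℝ) (hAcont : ContinuousOn A (Icc 0 M))
    (hA : ∀ t ∈ Icc (0:ℝ) M,
      -(F0 t * g1 t + (1 - F0 t) * g2 t) * A t
        + (1 - 2 * F0 t) * A t *
          ((∫ v in (0:ℝ)..t, (F0 t - F0 v) * g v t / (F0 t - F0 v))
            - ∫ u in t..M, (F0 u - F0 t) * g t u / (F0 u - F0 t))
        - F0 t * (1 - F0 t) *
          ((∫ u in (0:ℝ)..t, (F0 t - F0 u) * g u t * (A t - A u) / (F0 t - F0 u) ^ 2)
            + ∫ u in t..M, (F0 u - F0 t) * g t u * (A t - A u) / (F0 u - F0 t) ^ 2)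
        = 0) :
    ∀ t ∈ Icc (0:ℝ) M, A t = 0 := by
  have hF01 : ∀ t ∈ Icc (0:ℝ) M, 0 ≤ F0 t * (1 - F0 t) := by
    intro t ht
    have h0 := hF0mono (left_mem_Icc.2 hM.le) ht ht.1
    have h1 := hF0mono ht (right_mem_Icc.2 hM.le) ht.2
    exact mul_nonneg (by linarith) (by linarith)
  have hcancel : ∀ t u, t ∈ Icc (0:ℝ) M → u ∈ Icc (0:ℝ) M → F0 u - F0 t = 0 → g t u = 0 := by
    intro t u ht hu h
    refine hgsep t u (lt_of_not_ge fun hle => ?_)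
    linarith [hF0sep t u ht hu hle]
  have key : ∀ t ∈ Icc (0:ℝ) M,
      (g1 t * (1 - F0 t) + g2 t * F0 t) * A t + F0 t * (1 - F0 t) *
        ((∫ u in (0:ℝ)..t, (F0 t - F0 u) * g u t * (A t - A u) / (F0 t - F0 u) ^ 2)
          + ∫ u in t..M, (F0 u - F0 t) * g t u * (A t - A u) / (F0 u - F0 t) ^ 2) = 0 := by
    intro t ht
    have h := hA t ht
    rw [intervalIntegral_mul_div_cancel (d := fun v => F0 t - F0 v) (k := fun v => g v t),
      intervalIntegral_mul_div_cancel (d := fun u => F0 u - F0 t) (k := fun u => g t u),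
      ← hg1, ← hg2] at h
    · linear_combination -h
    · intro u hu hd
      rw [uIcc_of_le ht.2] at hu
      exact hcancel t u ht ⟨ht.1.trans hu.1, hu.2⟩ hd
    · intro v hv hd
      rw [uIcc_of_le ht.1] at hv
      exact hcancel v t ⟨hv.1, hv.2.trans ht.2⟩ ht hd
  have hleft : ∀ t ∈ Icc (0:ℝ) M, ∀ u ∈ Icc 0 t, u ∈ Icc 0 M ∧ 0 ≤ F0 t - F0 u := by
    intro t ht u hu
    have hu' : u ∈ Icc 0 M := ⟨hu.1, hu.2.trans ht.2⟩
    exact ⟨hu', sub_nonneg.2 (hF0mono hu' ht hu.2)⟩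
  have hright : ∀ t ∈ Icc (0:ℝ) M, ∀ u ∈ Icc t M, u ∈ Icc 0 M ∧ 0 ≤ F0 u - F0 t := by
    intro t ht u hu
    have hu' : u ∈ Icc 0 M := ⟨ht.1.trans hu.1, hu.2⟩
    exact ⟨hu', sub_nonneg.2 (hF0mono ht hu' hu.1)⟩
  have hne : (Icc (0:ℝ) M).Nonempty := nonempty_Icc.2 hM.le
  obtain ⟨p, hp, hmax⟩ := isCompact_Icc.exists_isMaxOn hne hAcont
  obtain ⟨q, hq, hmin⟩ := isCompact_Icc.exists_isMinOn hne hAcont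
  have hAp : A p ≤ 0 := by
    have h1 := intervalIntegral_weighted_nonneg hp.1 (fun u hu => (hleft p hp u hu).2)
      (fun u => hgnn u p) (fun u hu => sub_nonneg.2 (hmax (hleft p hp u hu).1))
    have h2 := intervalIntegral_weighted_nonneg hp.2 (fun u hu => (hright p hp u hu).2)
      (fun u => hgnn p u) (fun u hu => sub_nonneg.2 (hmax (hright p hp u hu).1))
    have h3 := mul_nonneg (hF01 p hp) (add_nonneg h1 h2)
    exact nonpos_of_mul_nonpos_right (by linarith [key p hp]) (hgpos p hp)
  have hAq : 0 ≤ A q := by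
    have h1 := intervalIntegral_weighted_nonpos hq.1 (fun u hu => (hleft q hq u hu).2)
      (fun u => hgnn u q) (fun u hu => sub_nonpos.2 (hmin (hleft q hq u hu).1))
    have h2 := intervalIntegral_weighted_nonpos hq.2 (fun u hu => (hright q hq u hu).2)
      (fun u => hgnn q u) (fun u hu => sub_nonpos.2 (hmin (hright q hq u hu).1))
    have h3 := mul_nonpos_of_nonneg_of_nonpos (hF01 q hq) (add_nonpos h1 h2)
    exact nonneg_of_mul_nonneg_right (by linarith [key q hq]) (hgpos q hq)
  exact fun t ht => le_antisymm ((hmax ht).trans hAp) (hAq.trans (hmin ht))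
end
end

section
/- Let p : [0,M] → ℝ be twice continuously differentiable. For b ∈ (0, M/2) define the boundary-corrected kernel smoothing (S_b p)(t) = ∫_0^M K_b(t−x) p(x) dx for t ∈ [b, M−b]; (S_b p)(t) = ∫_0^M [α(t/b) + β(t/b)·(t−x)/b] K_b(t−x) p(x) dx for t ∈ [0,b); and (S_b p)(t) = ∫_0^M [α((M−t)/b) − β((M−t)/b)·(t−x)/b] K_b(t−x) p(x) dx for t ∈ (M−b, M]. Then there exist C > 0 and b_0 > 0 such that sup_{t∈[0,M]} |(S_b p)(t) − p(t)| ≤ C b² for all b ∈ (0, b_0]; i.e. the uniform bias of the boundary-corrected kernel smoothing is O(b²) as b ↓ 0. -/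
open MeasureTheory Set Filter
open scoped ENNReal NNReal Topology

noncomputable section

/-- Scaled kernel `K_b(x) = K(x/b)/b`. -/
def Kb (K : ℝ → ℝ) (b x : ℝ) : ℝ := K (x / b) / b

/-- The boundary-corrected kernel smoothing `S_b p`. -/
def bcSmooth (K ka kb : ℝ → ℝ) (M b : ℝ) (p : ℝ → ℝ) (t : ℝ) : ℝ :=
  if t < b then
    ∫ x in (0:ℝ)..M, (ka (t / b) + kb (t / b) * (t - x) / b) * Kb K b (t - x) * p x
  else if M - b < t then
    ∫ x in (0:ℝ)..M,
      (ka ((M - t) / b) - kb ((M - t) / b) * (t - x) / b) * Kb K b (t - x) * p x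
  else ∫ x in (0:ℝ)..M, Kb K b (t - x) * p x

/-- First-order Taylor expansion with a uniform quadratic remainder on a compact interval. -/
theorem exists_taylor_quadratic_bound {M : ℝ} (hM : 0 < M) {p : ℝ → ℝ}
    (hp : ContDiffOn ℝ 2 p (Icc 0 M)) :
    ∃ q : ℝ → ℝ, ∃ D : ℝ, 0 ≤ D ∧ ∀ t ∈ Icc (0:ℝ) M, ∀ x ∈ Icc (0:ℝ) M,
      |p x - p t - q t * (x - t)| ≤ D * (x - t) ^ 2 := by
  have hu : UniqueDiffOn ℝ (Icc (0:ℝ) M) := uniqueDiffOn_Icc hM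
  have hq : ContDiffOn ℝ 1 (derivWithin p (Icc 0 M)) (Icc 0 M) :=
    hp.derivWithin hu (by norm_num)
  obtain ⟨D, hD⟩ := isCompact_Icc.exists_bound_of_continuousOn
    (hq.continuousOn_derivWithin hu le_rfl)
  have hD0 : 0 ≤ D := (norm_nonneg _).trans (hD 0 ⟨le_rfl, hM.le⟩)
  refine ⟨derivWithin p (Icc 0 M), D, hD0, fun t ht x hx => ?_⟩
  have hsub : uIcc t x ⊆ Icc 0 M := ordConnected_Icc.uIcc_subset ht hx
  have hderiv : ∀ y ∈ uIcc t x, HasDerivWithinAt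
      (fun y => p y - derivWithin p (Icc 0 M) t * y)
      (derivWithin p (Icc 0 M) y - derivWithin p (Icc 0 M) t) (uIcc t x) y := fun y hy => by
    have h1 := ((hp.differentiableOn (by norm_num) y (hsub hy)).hasDerivWithinAt).mono hsub
    have h2 := (hasDerivWithinAt_id y (uIcc t x)).const_mul (derivWithin p (Icc 0 M) t)
    rw [mul_one] at h2
    exact h1.sub h2
  have hbound : ∀ y ∈ uIcc t x,
      ‖derivWithin p (Icc 0 M) y - derivWithin p (Icc 0 M) t‖ ≤ D * |x - t| := fun y hy => by
    refine ((convex_Icc 0 M).norm_image_sub_le_of_norm_derivWithin_le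
      (hq.differentiableOn (by norm_num)) hD ht (hsub hy)).trans ?_
    exact mul_le_mul_of_nonneg_left (abs_sub_left_of_mem_uIcc hy) hD0
  have h := (convex_uIcc t x).norm_image_sub_le_of_norm_hasDerivWithin_le hderiv hbound
    left_mem_uIcc right_mem_uIcc
  rw [Real.norm_eq_abs, Real.norm_eq_abs, mul_assoc, ← sq, sq_abs] at h
  convert h using 2
  ring

/-- A bounded second-order weight supported in `[-1, 1]` reproduces smooth functions up to
`O(b²)`. -/
theorem abs_integral_weight_sub_le {M b t A D q : ℝ} {w p : ℝ → ℝ} (hM : 0 ≤ M) (hb : 0 < b)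
    (hD : 0 ≤ D) (hw : Continuous w) (hwA : ∀ s, |w s| ≤ A) (hw0 : ∀ s, 1 < |s| → w s = 0)
    (hp : ContinuousOn p (Icc 0 M))
    (htaylor : ∀ x ∈ Icc (0:ℝ) M, |p x - p t - q * (x - t)| ≤ D * (x - t) ^ 2)
    (hmass : ∫ s in ((t - M) / b)..(t / b), w s = 1)
    (hmoment : ∫ s in ((t - M) / b)..(t / b), s * w s = 0) :
    |(∫ x in (0:ℝ)..M, w ((t - x) / b) / b * p x) - p t| ≤ 2 * A * D * b ^ 2 := by
  have hA : 0 ≤ A := (abs_nonneg _).trans (hwA 0)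
  have hcont : Continuous fun x => w ((t - x) / b) / b := by fun_prop
  have hsubst : ∀ f : ℝ → ℝ, ∫ x in (0:ℝ)..M, f ((t - x) / b) / b
      = ∫ s in ((t - M) / b)..(t / b), f s := fun f => by
    rw [intervalIntegral.integral_div]
    simp_rw [sub_div]
    rw [intervalIntegral.integral_comp_sub_div _ hb.ne']
    simp [hb.ne']
  have h0 : ∫ x in (0:ℝ)..M, w ((t - x) / b) / b = 1 := (hsubst w).trans hmass
  have h1 : ∫ x in (0:ℝ)..M, w ((t - x) / b) / b * (x - t) = 0 := by
    have h := (hsubst fun s => s * w s).trans hmoment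
    have h2 : ∀ x, w ((t - x) / b) / b * (x - t)
        = -b * ((t - x) / b * w ((t - x) / b) / b) := fun x => by
      field_simp
      ring
    simp_rw [h2]
    rw [intervalIntegral.integral_const_mul, h, mul_zero]
  have hpi : IntervalIntegrable (fun x => w ((t - x) / b) / b * p x) volume 0 M := by
    apply ContinuousOn.intervalIntegrable
    rw [uIcc_of_le hM]
    exact hcont.continuousOn.mul hp
  have heq : (∫ x in (0:ℝ)..M, w ((t - x) / b) / b * p x) - p t
      = ∫ x in (0:ℝ)..M, w ((t - x) / b) / b * (p x - p t - q * (x - t)) := by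
    have h2 : ∀ x, w ((t - x) / b) / b * (p x - p t - q * (x - t))
        = w ((t - x) / b) / b * p x - (w ((t - x) / b) / b) * p t
          - (w ((t - x) / b) / b * (x - t)) * q := fun x => by ring
    simp_rw [h2]
    have hi1 : IntervalIntegrable (fun x => w ((t - x) / b) / b * p t) volume 0 M :=
      (hcont.mul continuous_const).intervalIntegrable _ _
    have hi2 : IntervalIntegrable (fun x => w ((t - x) / b) / b * (x - t) * q) volume 0 M :=
      Continuous.intervalIntegrable (by fun_prop) _ _
    rw [intervalIntegral.integral_sub (hpi.sub hi1) hi2, intervalIntegral.integral_sub hpi hi1,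
      intervalIntegral.integral_mul_const, intervalIntegral.integral_mul_const, h0, h1]
    ring
  have hind : Integrable ((Icc (t - b) (t + b)).indicator fun _ => A * D * b) := by
    rw [integrable_indicator_iff measurableSet_Icc]
    exact integrableOn_const (by simp)
  rw [heq, ← Real.norm_eq_abs]
  calc ‖∫ x in (0:ℝ)..M, w ((t - x) / b) / b * (p x - p t - q * (x - t))‖
      ≤ ∫ x in (0:ℝ)..M, (Icc (t - b) (t + b)).indicator (fun _ => A * D * b) x := by
        refine intervalIntegral.norm_integral_le_of_norm_le hM
          (Eventually.of_forall fun x hx => ?_) hind.intervalIntegrable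
        by_cases hxt : |(t - x) / b| ≤ 1
        · have hxt' : |t - x| ≤ b := by
            rwa [abs_div, abs_of_pos hb, div_le_one hb] at hxt
          have hmem : x ∈ Icc (t - b) (t + b) := by
            rw [abs_le] at hxt'
            constructor <;> linarith
          have hsq : (x - t) ^ 2 ≤ b ^ 2 := by
            rw [abs_sub_comm] at hxt'
            exact sq_le_sq' (abs_le.1 hxt').1 (abs_le.1 hxt').2
          rw [indicator_of_mem hmem, norm_mul, norm_div, Real.norm_eq_abs, Real.norm_eq_abs,
            Real.norm_eq_abs, abs_of_pos hb]
          calc |w ((t - x) / b)| / b * |p x - p t - q * (x - t)|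
              ≤ A / b * (D * b ^ 2) := by
                gcongr
                · exact hwA _
                · exact (htaylor x ⟨hx.1.le, hx.2⟩).trans (by gcongr)
            _ = A * D * b := by field_simp
        · rw [hw0 _ (not_le.1 hxt), zero_div, zero_mul, norm_zero]
          exact indicator_nonneg (fun _ _ => by positivity) x
    _ ≤ ∫ x, (Icc (t - b) (t + b)).indicator (fun _ => A * D * b) x := by
        rw [intervalIntegral.integral_of_le hM]
        exact setIntegral_le_integral hind
          (Eventually.of_forall (indicator_nonneg fun _ _ => by positivity))
    _ = 2 * A * D * b ^ 2 := by
        rw [integral_indicator measurableSet_Icc, setIntegral_const, smul_eq_mul,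
          Real.volume_real_Icc_of_le (by linarith)]
        ring

/-- The lower limit of an integral may be moved to `-1` if the integrand vanishes below. -/
theorem integral_eq_integral_from_neg_one {f : ℝ → ℝ} (hf : Continuous f)
    (hf0 : ∀ s, s ≤ -1 → f s = 0) {a u : ℝ} (ha : a ≤ -1) :
    ∫ s in a..u, f s = ∫ s in (-1:ℝ)..u, f s := by
  have h : ∫ s in a..(-1:ℝ), f s = 0 := by
    refine (intervalIntegral.integral_congr (g := fun _ => 0) fun s hs => ?_).trans (by simp)
    rw [uIcc_of_le ha] at hs
    exact hf0 s hs.2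
  rw [← intervalIntegral.integral_add_adjacent_intervals (hf.intervalIntegrable a (-1))
    (hf.intervalIntegrable _ _), h, zero_add]

/-- the uniform bias of the boundary-corrected kernel smoothing of a
twice continuously differentiable function is `O(b²)` as `b ↓ 0`. -/
theorem stmt_18
    (M : ℝ) (hM : 0 < M)
    (K : ℝ → ℝ) (hK : ContDiff ℝ 1 K) (hKsymm : ∀ x, K (-x) = K x)
    (hKsupp : ∀ x : ℝ, 1 < |x| → K x = 0) (hKint : (∫ x : ℝ, K x) = 1)
    (ka kb : ℝ → ℝ)
    (hkab1 : ∀ u ∈ Icc (0:ℝ) 1,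
      ka u * (∫ x in (-1:ℝ)..u, K x) + kb u * (∫ x in (-1:ℝ)..u, x * K x) = 1)
    (hkab2 : ∀ u ∈ Icc (0:ℝ) 1,
      ka u * (∫ x in (-1:ℝ)..u, x * K x) + kb u * (∫ x in (-1:ℝ)..u, x ^ 2 * K x) = 0)
    (hkabbd : ∃ C : ℝ, ∀ u ∈ Icc (0:ℝ) 1,
      |ka u| ≤ C ∧ |kb u| ≤ C ∧ |deriv ka u| ≤ C ∧ |deriv kb u| ≤ C)
    (p : ℝ → ℝ) (hp : ContDiffOn ℝ 2 p (Icc 0 M)) :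
    ∃ C > (0:ℝ), ∃ b0 > (0:ℝ), b0 < M / 2 ∧
      ∀ b : ℝ, 0 < b → b ≤ b0 →
        ∀ t ∈ Icc (0:ℝ) M, |bcSmooth K ka kb M b p t - p t| ≤ C * b ^ 2 := by
  have hKc : Continuous K := hK.continuous
  have hKneg : ∀ s, s ≤ -1 → K s = 0 := by
    have hcl : IsClosed {s | K s = 0} := isClosed_eq hKc continuous_const
    have hsub : Iio (-1:ℝ) ⊆ {s | K s = 0} := fun s hs =>
      hKsupp s (lt_abs.2 (Or.inr (by linarith [mem_Iio.1 hs])))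
    intro s hs
    exact hcl.closure_subset_iff.2 hsub (by rwa [closure_Iio])
  obtain ⟨B, hB⟩ : ∃ B, ∀ s, |K s| ≤ B := by
    have hc : HasCompactSupport K := HasCompactSupport.intro (isCompact_Icc (a := -1) (b := 1))
      fun s hs => hKsupp s (not_le.1 fun h => hs (abs_le.1 h))
    exact hc.exists_bound_of_continuous hKc
  have hB0 : 0 ≤ B := (abs_nonneg _).trans (hB 0)
  obtain ⟨C, hC⟩ := hkabbd
  obtain ⟨q, D, hD, hT⟩ := exists_taylor_quadratic_bound hM hp
  set A : ℝ := max C 1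
  have hA1 : 1 ≤ A := le_max_right _ _
  have hwc : ∀ c d : ℝ, Continuous fun s => (c + d * s) * K s := fun c d => by fun_prop
  have hw0 : ∀ c d s : ℝ, 1 < |s| → (c + d * s) * K s = 0 := fun c d s hs => by
    rw [hKsupp s hs, mul_zero]
  have hwA : ∀ c d : ℝ, |c| ≤ A → |d| ≤ A → ∀ s, |(c + d * s) * K s| ≤ 2 * A * B := by
    intro c d hc hd s
    by_cases hs : 1 < |s|
    · rw [hw0 c d s hs, abs_zero]
      positivity
    · rw [abs_mul]
      have h1 : |c + d * s| ≤ 2 * A := by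
        calc |c + d * s| ≤ |c| + |d * s| := abs_add_le _ _
          _ = |c| + |d| * |s| := by rw [abs_mul]
          _ ≤ A + A * 1 := by gcongr; exact not_lt.1 hs
          _ = 2 * A := by ring
      gcongr
      exact hB s
  have key : ∀ c d b t : ℝ, |c| ≤ A → |d| ≤ A → 0 < b → t ∈ Icc (0:ℝ) M →
      (∫ s in ((t - M) / b)..(t / b), (c + d * s) * K s = 1) →
      (∫ s in ((t - M) / b)..(t / b), s * ((c + d * s) * K s) = 0) →
      |(∫ x in (0:ℝ)..M, (c + d * (t - x) / b) * Kb K b (t - x) * p x) - p t|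
        ≤ (2 * (2 * A * B) * D + 1) * b ^ 2 := by
    intro c d b t hc hd hb ht h0 h1
    have h := abs_integral_weight_sub_le hM.le hb hD (hwc c d) (hwA c d hc hd) (hw0 c d)
      hp.continuousOn (hT t ht) h0 h1
    have he : ∀ x, (c + d * (t - x) / b) * Kb K b (t - x) * p x
        = (c + d * ((t - x) / b)) * K ((t - x) / b) / b * p x := fun x => by
      rw [Kb]
      ring
    simp_rw [he]
    exact h.trans (by gcongr; linarith)
  have hlin : ∀ c d a u : ℝ, ∫ s in a..u, (c + d * s) * K s
      = c * (∫ s in a..u, K s) + d * ∫ s in a..u, s * K s := fun c d a u => by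
    rw [← intervalIntegral.integral_const_mul, ← intervalIntegral.integral_const_mul,
      ← intervalIntegral.integral_add (Continuous.intervalIntegrable (by fun_prop) _ _)
        (Continuous.intervalIntegrable (by fun_prop) _ _)]
    congr 1 with s
    ring
  have hquad : ∀ c d a u : ℝ, ∫ s in a..u, s * ((c + d * s) * K s)
      = c * (∫ s in a..u, s * K s) + d * ∫ s in a..u, s ^ 2 * K s := fun c d a u => by
    rw [← intervalIntegral.integral_const_mul, ← intervalIntegral.integral_const_mul,
      ← intervalIntegral.integral_add (Continuous.intervalIntegrable (by fun_prop) _ _)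
        (Continuous.intervalIntegrable (by fun_prop) _ _)]
    congr 1 with s
    ring
  have hleft : ∀ u ∈ Icc (0:ℝ) 1, ∀ a ≤ (-1:ℝ),
      (∫ s in a..u, (ka u + kb u * s) * K s = 1) ∧
      ∫ s in a..u, s * ((ka u + kb u * s) * K s) = 0 := by
    intro u hu a ha
    have hwc' : Continuous fun s => s * ((ka u + kb u * s) * K s) := by fun_prop
    rw [integral_eq_integral_from_neg_one (hwc _ _) (fun s hs => by rw [hKneg s hs, mul_zero]) ha,
      integral_eq_integral_from_neg_one hwc'
        (fun s hs => by rw [hKneg s hs, mul_zero, mul_zero]) ha, hlin, hquad]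
    exact ⟨hkab1 u hu, hkab2 u hu⟩
  have hright : ∀ u ∈ Icc (0:ℝ) 1, ∀ a ≥ (1:ℝ),
      (∫ s in (-u)..a, (ka u + -kb u * s) * K s = 1) ∧
      ∫ s in (-u)..a, s * ((ka u + -kb u * s) * K s) = 0 := by
    intro u hu a ha
    obtain ⟨h0, h1⟩ := hleft u hu (-a) (by linarith)
    constructor
    · rw [← h0, ← neg_neg a, ← intervalIntegral.integral_comp_neg, neg_neg]
      congr 1 with s
      rw [hKsymm]
      ring
    · rw [← neg_eq_zero, ← h1, ← neg_neg a, ← intervalIntegral.integral_comp_neg, neg_neg,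
        ← intervalIntegral.integral_neg]
      congr 1 with s
      rw [hKsymm]
      ring
  have hmid : ∀ a ≤ (-1:ℝ), ∀ u ≥ (1:ℝ),
      (∫ s in a..u, (1 + 0 * s) * K s = 1) ∧
      ∫ s in a..u, s * ((1 + 0 * s) * K s) = 0 := by
    have hfull : ∀ f : ℝ → ℝ, (∀ s, f s = 0 ∨ K s ≠ 0) → ∀ a ≤ (-1:ℝ), ∀ u ≥ (1:ℝ),
        ∫ s in a..u, f s = ∫ s, f s := by
      intro f hf a ha u hu
      refine intervalIntegral.integral_eq_integral_of_support_subset fun s hs => ?_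
      have hKs : K s ≠ 0 := (hf s).resolve_left hs
      have h1 : -1 < s := not_le.1 fun h => hKs (hKneg s h)
      have h2 : s < 1 := not_le.1 fun h => hKs (hKsymm s ▸ hKneg (-s) (by linarith))
      exact ⟨by linarith, by linarith⟩
    intro a ha u hu
    simp only [zero_mul, add_zero, one_mul]
    refine ⟨(hfull K (fun s => em _) a ha u hu).trans hKint, ?_⟩
    rw [hfull (fun s => s * K s) (fun s => (em (K s = 0)).imp_left fun h => by simp [h]) a ha u hu]
    have h := integral_neg_eq_self (fun s => s * K s) volume
    simp only [hKsymm, neg_mul, integral_neg] at h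
    linarith
  refine ⟨2 * (2 * A * B) * D + 1, by positivity, M / 4, by linarith, by linarith,
    fun b hb hbM t ht => ?_⟩
  unfold bcSmooth
  split_ifs with h1 h2
  · have hu : t / b ∈ Icc (0:ℝ) 1 := ⟨div_nonneg ht.1 hb.le, (div_le_one hb).2 h1.le⟩
    obtain ⟨hm0, hm1⟩ := hleft _ hu ((t - M) / b) (by rw [div_le_iff₀ hb]; linarith)
    exact key _ _ b t ((hC _ hu).1.trans (le_max_left _ _))
      ((hC _ hu).2.1.trans (le_max_left _ _)) hb ht hm0 hm1
  · have hu : (M - t) / b ∈ Icc (0:ℝ) 1 :=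
      ⟨div_nonneg (by linarith [ht.2]) hb.le, (div_le_one hb).2 (by linarith)⟩
    obtain ⟨hm0, hm1⟩ := hright _ hu (t / b) (by rw [ge_iff_le, le_div_iff₀ hb]; linarith)
    have he : -((M - t) / b) = (t - M) / b := by ring
    rw [he] at hm0 hm1
    have h := key _ (-kb ((M - t) / b)) b t ((hC _ hu).1.trans (le_max_left _ _))
      (by rw [abs_neg]; exact (hC _ hu).2.1.trans (le_max_left _ _)) hb ht hm0 hm1
    simpa only [neg_mul, neg_div, ← sub_eq_add_neg] using h
  · obtain ⟨hm0, hm1⟩ := hmid ((t - M) / b) (by rw [div_le_iff₀ hb]; linarith) (t / b)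
      (by rw [ge_iff_le, le_div_iff₀ hb]; linarith)
    have h := key 1 0 b t (by simpa using hA1) (by rw [abs_zero]; positivity) hb ht hm0 hm1
    simpa using h
end
end
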